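/- Let m ∈ ℕ, n ≥ 100(m+1), b ∈ ℝ^m, and let W := [cᵀ; A] ∈ ℝ^{(m+1)×n} (the matrix whose first row is cᵀ and remaining rows form A) be a random matrix whose columns are independent logconcave random vectors in ℝ^{m+1}, each with identity covariance matrix. Then for every G ≥ 0 and δ ∈ (0,1), with probability at least 1 − δ − e^{−n/5}: max over λ ∈ ℝ^m of |{x ∈ {0,1}^n : Σ_{i=1}^n x_i·|(c − Aᵀλ)_i| ≤ G}| is at most 60·(357·n⁶)^{m+2}·e^{2√(2nG)}/δ. -/

import Mathlib

open MeasureTheory ProbabilityTheory ENNReal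

/-- A random vector in `ℝ^d` (with law `μ`) is logconcave if its law has a density `f ≥ 0`
w.r.t. Lebesgue measure such that `log f` is concave, i.e.
`f(x)^t · f(y)^{1−t} ≤ f(tx + (1−t)y)` for all `x, y` and `t ∈ [0,1]`. -/
def IsLogConcave {d : ℕ} (μ : Measure (Fin d → ℝ)) : Prop :=
  ∃ f : (Fin d → ℝ) → ℝ, (∀ x, 0 ≤ f x) ∧
    μ = MeasureTheory.volume.withDensity (fun x => ENNReal.ofReal (f x)) ∧
    ∀ x y : Fin d → ℝ, ∀ t : ℝ, 0 ≤ t → t ≤ 1 →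
      f x ^ t * f y ^ (1 - t) ≤ f (t • x + (1 - t) • y)

/-- A random vector in `ℝ^d` (with law `μ`) has identity covariance. -/
def HasIdCovariance {d : ℕ} (μ : Measure (Fin d → ℝ)) : Prop :=
  ∀ i j : Fin d,
    (∫ x, x i * x j ∂μ) - (∫ x, x i ∂μ) * (∫ x, x j ∂μ) = if i = j then 1 else 0


open Pointwise in
/-- One-dimensional Brunn-Minkowski for compact sets. -/
lemma bm_compact {K L C : Set ℝ} (hK : IsCompact K) (hL : IsCompact L) (hKn : K.Nonempty)
    (hLn : L.Nonempty) (t : ℝ) (ht0 : 0 < t) (ht1 : t < 1)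
    (hC : ∀ x ∈ K, ∀ y ∈ L, t * x + (1 - t) * y ∈ C) :
    ENNReal.ofReal t * volume K + ENNReal.ofReal (1 - t) * volume L ≤ volume C := by
  obtain ⟨a, haK, ha⟩ := hK.exists_isGreatest hKn
  obtain ⟨b, hbL, hb⟩ := hL.exists_isLeast hLn
  have h1t : 0 < 1 - t := by linarith
  set A : Set ℝ := (fun x => t * x + (1 - t) * b) '' K with hA
  set B : Set ℝ := (fun y => t * a + (1 - t) * y) '' L with hB
  have hAc : IsCompact A := hK.image (by fun_prop)
  have hBc : IsCompact B := hL.image (by fun_prop)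
  have vA : volume A = ENNReal.ofReal t * volume K := by
    have : A = (fun x => x + (1 - t) * b) '' (t • K) := by
      rw [hA, ← Set.image_smul, Set.image_image]; simp
    rw [this, Set.image_add_right, measure_preimage_add_right, Measure.addHaar_smul]
    simp [abs_of_pos ht0]
  have vB : volume B = ENNReal.ofReal (1 - t) * volume L := by
    have : B = (fun x => t * a + x) '' ((1 - t) • L) := by
      rw [hB, ← Set.image_smul, Set.image_image]; simp
    rw [this, Set.image_add_left, measure_preimage_add, Measure.addHaar_smul]
    simp [abs_of_pos h1t]
  have hd : AEDisjoint volume A B := by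
    refine measure_mono_null (t := {t * a + (1 - t) * b}) ?_ (by simp)
    rintro z ⟨⟨x, hx, rfl⟩, ⟨y, hy, hxy⟩⟩
    have h1 := ha hx
    have h2 := hb hy
    simp only at hxy
    simp only [Set.mem_singleton_iff]
    nlinarith
  rw [← vA, ← vB, ← measure_union₀ hBc.measurableSet.nullMeasurableSet hd]
  apply measure_mono
  rintro z (⟨x, hx, rfl⟩ | ⟨y, hy, rfl⟩)
  · exact hC x hx b hbL
  · exact hC a haK y hy

lemma bm_one {A B C : Set ℝ} (hA : MeasurableSet A) (hB : MeasurableSet B) (hAn : A.Nonempty)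
    (hBn : B.Nonempty) (t : ℝ) (ht0 : 0 < t) (ht1 : t < 1)
    (hC : ∀ x ∈ A, ∀ y ∈ B, t * x + (1 - t) * y ∈ C) :
    ENNReal.ofReal t * volume A + ENNReal.ofReal (1 - t) * volume B ≤ volume C := by
  obtain ⟨a, ha⟩ := hAn
  obtain ⟨b, hb⟩ := hBn
  have key : ∀ K ⊆ A, IsCompact K → ∀ L ⊆ B, IsCompact L →
      ENNReal.ofReal t * volume K + ENNReal.ofReal (1 - t) * volume L ≤ volume C := by
    intro K hKA hK L hLB hL
    refine le_trans ?_ (bm_compact (hK.insert a) (hL.insert b) (Set.insert_nonempty _ _)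
      (Set.insert_nonempty _ _) t ht0 ht1 (C := C) ?_)
    · gcongr <;> exact Set.subset_insert _ _
    · intro x hx y hy
      exact hC x (Set.insert_subset ha hKA hx) y (Set.insert_subset hb hLB hy)
  have step1 : ∀ K ⊆ A, IsCompact K →
      ENNReal.ofReal t * volume K + ENNReal.ofReal (1 - t) * volume B ≤ volume C := by
    intro K hKA hK
    have hKt : ENNReal.ofReal t * volume K ≠ ⊤ :=
      ENNReal.mul_ne_top ENNReal.ofReal_ne_top hK.measure_lt_top.ne
    have h0 : ENNReal.ofReal t * volume K ≤ volume C := by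
      simpa using key K hKA hK ∅ (by simp) (by simp)
    rw [add_comm]
    refine add_le_of_le_tsub_right_of_le h0 ?_
    rw [hB.measure_eq_iSup_isCompact]
    simp only [ENNReal.mul_iSup, iSup_le_iff]
    intro L hL1 hL2
    refine ENNReal.le_sub_of_add_le_right hKt ?_
    rw [add_comm]
    exact key K hKA hK L hL1 hL2
  by_cases hBt : volume B = ⊤
  · have := step1 ∅ (by simp) (by simp)
    rw [hBt, ENNReal.mul_top (by simpa using ht1)] at this
    simp at this
    simp [this]
  have hBt' : ENNReal.ofReal (1 - t) * volume B ≠ ⊤ := ENNReal.mul_ne_top ENNReal.ofReal_ne_top hBt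
  refine add_le_of_le_tsub_right_of_le (by simpa using step1 ∅ (by simp) (by simp)) ?_
  rw [hA.measure_eq_iSup_isCompact]
  simp only [ENNReal.mul_iSup, iSup_le_iff]
  intro L hL1 hL2
  exact ENNReal.le_sub_of_add_le_right hBt' (step1 L hL1 hL2)

/-- Layer cake for functions bounded by one. -/
lemma layer_one {f : ℝ → ℝ≥0∞} (hf : Measurable f) (h1 : ∀ x, f x ≤ 1) :
    ∫⁻ x, f x = ∫⁻ r in Set.Ioo (0:ℝ) 1, volume {x | ENNReal.ofReal r < f x} := by
  have hfin : ∀ x, f x ≠ ⊤ := fun x => ne_top_of_le_ne_top one_ne_top (h1 x)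
  have e1 : ∫⁻ x, f x = ∫⁻ x, ENNReal.ofReal (f x).toReal := by
    simp [ENNReal.ofReal_toReal, hfin]
  rw [e1, lintegral_eq_lintegral_meas_lt _ (by filter_upwards with x; simp)
    hf.ennreal_toReal.aemeasurable]
  have e2 : ∀ r ∈ Set.Ioi (0:ℝ), volume {x | r < (f x).toReal} =
      (Set.Ioo (0:ℝ) 1).indicator (fun r => volume {x | ENNReal.ofReal r < f x}) r := by
    intro r hr
    by_cases hr1 : r < 1
    · rw [Set.indicator_of_mem (by exact ⟨hr, hr1⟩)]
      congr 1
      ext x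
      simp only [Set.mem_ofPred_eq]
      rw [ENNReal.ofReal_lt_iff_lt_toReal (le_of_lt hr) (hfin x)]
    · rw [Set.indicator_of_notMem (by simp [hr1])]
      have : {x | r < (f x).toReal} = ∅ := by
        ext x
        simp only [Set.mem_ofPred_eq, Set.mem_empty_iff_false, iff_false, not_lt]
        have := ENNReal.toReal_mono one_ne_top (h1 x)
        simp at this
        linarith
      rw [this]; simp
  rw [setLIntegral_congr_fun measurableSet_Ioi e2, setLIntegral_indicator measurableSet_Ioo,
    Set.inter_eq_left.2 Set.Ioo_subset_Ioi_self]

lemma pl_norm {f g h : ℝ → ℝ≥0∞} (hf : Measurable f) (hg : Measurable g) (hh : Measurable h)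
    (t : ℝ) (ht0 : 0 < t) (ht1 : t < 1)
    (H : ∀ x y, f x ^ t * g y ^ (1 - t) ≤ h (t * x + (1 - t) * y))
    (f1 : ∀ x, f x ≤ 1) (g1 : ∀ x, g x ≤ 1)
    (fs : ∀ r < 1, ∃ x, r < f x) (gs : ∀ r < 1, ∃ x, r < g x) :
    ENNReal.ofReal t * (∫⁻ x, f x) + ENNReal.ofReal (1 - t) * (∫⁻ x, g x) ≤ ∫⁻ x, h x := by
  have h1t : 0 < 1 - t := by linarith
  have hle : ∫⁻ x, min (h x) 1 ≤ ∫⁻ x, h x := lintegral_mono fun x => min_le_left _ _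
  refine le_trans ?_ hle
  rw [layer_one hf f1, layer_one hg g1, layer_one (hh.min measurable_const) (fun x => min_le_right _ _),
    ← lintegral_const_mul' _ _ ENNReal.ofReal_ne_top, ← lintegral_const_mul' _ _ ENNReal.ofReal_ne_top,
    ← lintegral_add_left']
  · refine setLIntegral_mono' measurableSet_Ioo fun r hr => ?_
    have hr1 : ENNReal.ofReal r < 1 := by simpa using hr.2
    apply bm_one (measurableSet_lt measurable_const hf) (measurableSet_lt measurable_const hg)
      (fs _ hr1) (gs _ hr1) t ht0 ht1
    intro x hx y hy
    simp only [Set.mem_ofPred_eq] at hx hy ⊢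
    refine lt_min ?_ hr1
    refine lt_of_lt_of_le ?_ (H x y)
    have e : ENNReal.ofReal r = ENNReal.ofReal r ^ t * ENNReal.ofReal r ^ (1 - t) := by
      rw [← ENNReal.rpow_add_of_nonneg _ _ ht0.le h1t.le]; simp
    rw [e]
    exact ENNReal.mul_lt_mul (ENNReal.rpow_lt_rpow hx ht0) (ENNReal.rpow_lt_rpow hy h1t)
  · apply Measurable.aemeasurable
    apply Measurable.const_mul
    apply Antitone.measurable
    intro r s hrs
    apply measure_mono
    intro x hx
    simp only [Set.mem_ofPred_eq] at hx ⊢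
    exact lt_of_le_of_lt (ENNReal.ofReal_le_ofReal hrs) hx

lemma amgm_enn (a b : ℝ≥0∞) (t : ℝ) (ht0 : 0 < t) (ht1 : t < 1) :
    a ^ t * b ^ (1 - t) ≤ ENNReal.ofReal t * a + ENNReal.ofReal (1 - t) * b := by
  have h1t : 0 < 1 - t := by linarith
  by_cases ha : a = ⊤
  · rw [ha, ENNReal.mul_top (by simpa using ht0)]; simp
  by_cases hb : b = ⊤
  · rw [hb, ENNReal.mul_top (by simpa using ht1)]; simp
  lift a to NNReal using ha
  lift b to NNReal using hb
  lift t to NNReal using ht0.le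
  have ht1' : t ≤ 1 := by exact_mod_cast ht1.le
  have := NNReal.geom_mean_le_arith_mean2_weighted t (1 - t) a b (add_tsub_cancel_of_le ht1')
  rw [NNReal.coe_sub ht1'] at this
  have e1 : ENNReal.ofReal t = (t : ℝ≥0∞) := ENNReal.ofReal_coe_nnreal
  have e2 : ENNReal.ofReal (1 - (t : ℝ)) = ((1 - t : NNReal) : ℝ≥0∞) := by
    rw [← ENNReal.ofReal_coe_nnreal, NNReal.coe_sub ht1']; simp
  rw [e1, e2, ← ENNReal.coe_rpow_of_nonneg _ ht0.le, ← ENNReal.coe_rpow_of_nonneg _ h1t.le]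
  simp only [NNReal.coe_one] at this
  exact_mod_cast this

lemma pl_bdd {f g h : ℝ → ℝ≥0∞} (hf : Measurable f) (hg : Measurable g) (hh : Measurable h)
    (t : ℝ) (ht0 : 0 < t) (ht1 : t < 1)
    (H : ∀ x y, f x ^ t * g y ^ (1 - t) ≤ h (t * x + (1 - t) * y))
    (N : ℝ≥0∞) (hN : N ≠ ⊤) (f1 : ∀ x, f x ≤ N) (g1 : ∀ x, g x ≤ N) :
    (∫⁻ x, f x) ^ t * (∫⁻ x, g x) ^ (1 - t) ≤ ∫⁻ x, h x := by
  have h1t : 0 < 1 - t := by linarith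
  set a := ⨆ x, f x with ha
  set b := ⨆ x, g x with hb
  have haT : a ≠ ⊤ := ne_top_of_le_ne_top hN (iSup_le f1)
  have hbT : b ≠ ⊤ := ne_top_of_le_ne_top hN (iSup_le g1)
  by_cases ha0 : a = 0
  · have : ∀ x, f x = 0 := fun x => le_antisymm (ha0 ▸ le_iSup f x) (zero_le)
    simp [this, ENNReal.zero_rpow_of_pos ht0]
  by_cases hb0 : b = 0
  · have : ∀ x, g x = 0 := fun x => le_antisymm (hb0 ▸ le_iSup g x) (zero_le)
    simp [this, ENNReal.zero_rpow_of_pos h1t]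
  set c := a ^ t * b ^ (1 - t) with hc
  have hc0 : c ≠ 0 := mul_ne_zero (by simp [ha0, haT]) (by simp [hb0, hbT])
  have hcT : c ≠ ⊤ := ENNReal.mul_ne_top (by simp [ha0, haT]) (by simp [hb0, hbT])
  have hsup : ∀ (f : ℝ → ℝ≥0∞) (a : ℝ≥0∞), a = ⨆ x, f x → a ≠ 0 → a ≠ ⊤ →
      (∀ x, a⁻¹ * f x ≤ 1) ∧ ∀ r < 1, ∃ x, r < a⁻¹ * f x := by
    intro f a ha ha0 haT
    constructor
    · intro x
      calc a⁻¹ * f x ≤ a⁻¹ * a := by gcongr; rw [ha]; exact le_iSup f x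
        _ = 1 := ENNReal.inv_mul_cancel ha0 haT
    · intro r hr
      have : a * r < a := by
        simpa using ENNReal.mul_lt_mul_right ha0 haT hr
      conv_rhs at this => rw [ha]
      obtain ⟨x, hx⟩ := lt_iSup_iff.1 this
      refine ⟨x, ?_⟩
      rw [mul_comm, ← div_eq_mul_inv, ENNReal.lt_div_iff_mul_lt (Or.inl ha0) (Or.inl haT), mul_comm]
      exact hx
  have hcinv : c⁻¹ = a⁻¹ ^ t * b⁻¹ ^ (1 - t) := by
    rw [hc, ENNReal.inv_rpow, ENNReal.inv_rpow, ENNReal.mul_inv (by simp [ha0, haT]) (by simp [hb0, hbT])]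
  have main := pl_norm (hf.const_mul a⁻¹) (hg.const_mul b⁻¹) (hh.const_mul c⁻¹) t ht0 ht1
    (by
      intro x y
      rw [ENNReal.mul_rpow_of_nonneg _ _ ht0.le, ENNReal.mul_rpow_of_nonneg _ _ h1t.le, hcinv]
      calc _ = (a⁻¹ ^ t * b⁻¹ ^ (1 - t)) * (f x ^ t * g y ^ (1 - t)) := by ring
        _ ≤ _ := by gcongr; exact H x y)
    (hsup f a ha ha0 haT).1 (hsup g b hb hb0 hbT).1 (hsup f a ha ha0 haT).2 (hsup g b hb hb0 hbT).2
  have main2 := (amgm_enn _ _ t ht0 ht1).trans main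
  rw [lintegral_const_mul _ hf, lintegral_const_mul _ hg, lintegral_const_mul _ hh,
    ENNReal.mul_rpow_of_nonneg _ _ ht0.le, ENNReal.mul_rpow_of_nonneg _ _ h1t.le, hcinv] at main2
  have main3 : c⁻¹ * ((∫⁻ x, f x) ^ t * (∫⁻ x, g x) ^ (1 - t)) ≤ c⁻¹ * ∫⁻ x, h x := by
    rw [hcinv]
    calc _ = _ := by ring
      _ ≤ _ := main2
  exact (ENNReal.mul_le_mul_iff_right (by simp [hcT]) (by simp [hc0])).1 main3

/-- One-dimensional Prékopa-Leindler. -/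
lemma pl_one {f g h : ℝ → ℝ≥0∞} (hf : Measurable f) (hg : Measurable g) (hh : Measurable h)
    (t : ℝ) (ht0 : 0 < t) (ht1 : t < 1)
    (H : ∀ x y, f x ^ t * g y ^ (1 - t) ≤ h (t * x + (1 - t) * y)) :
    (∫⁻ x, f x) ^ t * (∫⁻ x, g x) ^ (1 - t) ≤ ∫⁻ x, h x := by
  have h1t : 0 < 1 - t := by linarith
  by_cases hf0 : ∫⁻ x, f x = 0
  · simp [hf0, ENNReal.zero_rpow_of_pos ht0]
  by_cases hg0 : ∫⁻ x, g x = 0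
  · simp [hg0, ENNReal.zero_rpow_of_pos h1t]
  have lim : ∀ f : ℝ → ℝ≥0∞, Measurable f →
      Filter.Tendsto (fun N : ℕ => ∫⁻ x, min (f x) N) Filter.atTop (nhds (∫⁻ x, f x)) := by
    intro f hf
    apply lintegral_tendsto_of_tendsto_of_monotone
    · intro N; exact (hf.min measurable_const).aemeasurable
    · filter_upwards with x i j hij
      exact min_le_min le_rfl (by exact_mod_cast hij)
    · filter_upwards with x
      have := (tendsto_const_nhds (x := f x)).min ENNReal.tendsto_nat_nhds_top
      simpa using this
  have l1 := ((ENNReal.continuous_rpow_const (y := t)).tendsto _).comp (lim f hf)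
  have l2 := ((ENNReal.continuous_rpow_const (y := 1 - t)).tendsto _).comp (lim g hg)
  have l3 := ENNReal.Tendsto.mul l1 (Or.inl (by simp [hf0, ht0, ht0.le])) l2 (Or.inl (by simp [hg0, h1t, ht1.le]))
  refine le_of_tendsto' l3 fun N => ?_
  refine pl_bdd (hf.min measurable_const) (hg.min measurable_const) hh t ht0 ht1 ?_ N (by simp)
    (fun x => min_le_right _ _) (fun x => min_le_right _ _)
  intro x y
  refine le_trans ?_ (H x y)
  gcongr <;> exact min_le_left _ _

/-- Logconcavity of an extended-nonnegative function. -/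
def LC {V : Type*} [AddCommGroup V] [Module ℝ V] (g : V → ℝ≥0∞) : Prop :=
  ∀ x y : V, ∀ t : ℝ, 0 < t → t < 1 → g x ^ t * g y ^ (1 - t) ≤ g (t • x + (1 - t) • y)

lemma lintegral_fin_succ (k : ℕ) (j : Fin (k + 1)) (F : (Fin (k + 1) → ℝ) → ℝ≥0∞)
    (hF : Measurable F) :
    ∫⁻ x, F x = ∫⁻ x : Fin k → ℝ, ∫⁻ s : ℝ, F (j.insertNth s x) := by
  have := (volume_preserving_piFinSuccAbove (fun _ : Fin (k + 1) => ℝ) j).symm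
  rw [← this.lintegral_comp hF]
  change ∫⁻ (a : ℝ × (Fin k → ℝ)), _ ∂((volume : Measure ℝ).prod (volume : Measure (Fin k → ℝ))) = _
  rw [lintegral_prod_symm]
  · rfl
  · exact (hF.comp (MeasurableEquiv.measurable _)).aemeasurable

lemma measurable_insertNth (k : ℕ) (j : Fin (k + 1)) :
    Measurable (fun p : ℝ × (Fin k → ℝ) => (j.insertNth p.1 p.2 : Fin (k + 1) → ℝ)) :=
  (MeasurableEquiv.piFinSuccAbove (fun _ : Fin (k + 1) => ℝ) j).symm.measurable

lemma lc_marginal (k : ℕ) : ∀ F : (Fin k → ℝ) × ℝ → ℝ≥0∞, Measurable F → LC F →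
    LC (fun u : ℝ => ∫⁻ x, F (x, u)) := by
  induction k with
  | zero =>
    intro F hF hL u v t h0 h1
    have := hL (default, u) (default, v) t h0 h1
    simp only [volume_pi, Measure.pi_of_empty (fun _ : Fin 0 => (volume : Measure ℝ)) default,
      lintegral_dirac]
    refine this.trans (le_of_eq ?_)
    congr 1
    ext i
    · exact i.elim0
    · rfl
  | succ k ih =>
    intro F hF hL
    have hm : Measurable (fun p : ((Fin k → ℝ) × ℝ) × ℝ =>
        F ((Fin.insertNth 0 p.2 p.1.1 : Fin (k + 1) → ℝ), p.1.2)) := by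
      refine hF.comp (Measurable.prodMk ?_ (by fun_prop))
      exact (measurable_insertNth k 0).comp (by fun_prop : Measurable
        (fun p : ((Fin k → ℝ) × ℝ) × ℝ => (p.2, p.1.1)))
    have e : (fun u : ℝ => ∫⁻ x, F (x, u)) = fun u : ℝ => ∫⁻ x : Fin k → ℝ, (fun p : (Fin k → ℝ) × ℝ =>
        ∫⁻ s : ℝ, F ((Fin.insertNth 0 s p.1 : Fin (k + 1) → ℝ), p.2)) (x, u) := by
      ext u
      exact lintegral_fin_succ k 0 (fun x => F (x, u)) (hF.comp (by fun_prop))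
    rw [e]
    refine ih (fun p : (Fin k → ℝ) × ℝ =>
        ∫⁻ s : ℝ, F ((Fin.insertNth 0 s p.1 : Fin (k + 1) → ℝ), p.2)) ?_ ?_
    · exact hm.lintegral_prod_right'
    · intro p q t h0 h1
      have mm : ∀ p : (Fin k → ℝ) × ℝ, Measurable fun s : ℝ =>
          F ((Fin.insertNth 0 s p.1 : Fin (k + 1) → ℝ), p.2) := fun p =>
        hm.comp (by fun_prop : Measurable (fun s : ℝ => (p, s)))
      refine pl_one (mm p) (mm q) (mm _) t h0 h1 ?_
      intro x y
      refine (hL _ _ t h0 h1).trans (le_of_eq ?_)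
      congr 1
      ext i
      · refine Fin.cases ?_ (fun i => ?_) i <;> simp
      · rfl

lemma lc_four {g : ℝ → ℝ≥0∞} (hg : LC g) {a b c d : ℝ} (hac : a ≤ c) (hcb : c ≤ b)
    (h : a + b = c + d) : g a * g b ≤ g c * g d := by
  rcases eq_or_lt_of_le hac with rfl | hac
  · have : b = d := by linarith
    rw [this]
  rcases eq_or_lt_of_le hcb with rfl | hcb
  · have : a = d := by linarith
    rw [this, mul_comm]
  have hab : 0 < b - a := by linarith
  set t := (b - c) / (b - a) with ht
  have h0 : 0 < t := div_pos (by linarith) hab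
  have h1 : t < 1 := by rw [ht, div_lt_one hab]; linarith
  have h1t : 0 < 1 - t := by linarith
  have hta : t * (b - a) = b - c := by rw [ht]; field_simp
  have e1 := hg a b t h0 h1
  have e2 := hg a b (1 - t) h1t (by linarith)
  have c1 : t • a + (1 - t) • b = c := by simp only [smul_eq_mul]; linarith
  have c2 : (1 - t) • a + (1 - (1 - t)) • b = d := by simp only [smul_eq_mul]; linarith
  rw [c1] at e1
  rw [c2] at e2
  calc g a * g b = (g a ^ t * g b ^ (1 - t)) * (g a ^ (1 - t) * g b ^ (1 - (1 - t))) := by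
        have q1 : g a = g a ^ t * g a ^ (1 - t) := by
          rw [← ENNReal.rpow_add_of_nonneg _ _ h0.le h1t.le]; simp
        have q2 : g b = g b ^ (1 - t) * g b ^ (1 - (1 - t)) := by
          rw [← ENNReal.rpow_add_of_nonneg _ _ h1t.le (by linarith)]; simp
        conv_lhs => rw [q1, q2]
        ring
    _ ≤ _ := mul_le_mul' e1 e2

/-- Tonelli on the positive quadrant. -/
lemma tonelli_tri {k h : ℝ → ℝ≥0∞} (hk : Measurable k) (hh : Measurable h) :
    ∫⁻ x in Set.Ioi (0:ℝ), k x * ∫⁻ z in Set.Ioi (0:ℝ), h (x + z) =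
      ∫⁻ u in Set.Ioi (0:ℝ), h u * ∫⁻ x in Set.Ioo (0:ℝ) u, k x := by
  have e1 : ∀ x : ℝ, 0 < x → k x * ∫⁻ z in Set.Ioi (0:ℝ), h (x + z) =
      ∫⁻ u in Set.Ioi (0:ℝ), (if x < u then k x * h u else 0) := by
    intro x hx
    rw [← lintegral_indicator measurableSet_Ioi, ← lintegral_indicator measurableSet_Ioi,
      ← lintegral_const_mul _ (by
        exact (hh.comp (measurable_const_add x)).indicator measurableSet_Ioi)]
    rw [← lintegral_add_left_eq_self (fun u => (Set.Ioi (0:ℝ)).indicator _ u) x]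
    refine lintegral_congr fun z => ?_
    by_cases hz : 0 < z
    · have : 0 < x + z := by linarith
      simp [Set.indicator, hz, this]
    · simp [Set.indicator, hz]
  have e2 : ∀ u : ℝ, 0 < u → h u * ∫⁻ x in Set.Ioo (0:ℝ) u, k x =
      ∫⁻ x in Set.Ioi (0:ℝ), (if x < u then k x * h u else 0) := by
    intro u hu
    rw [← lintegral_indicator measurableSet_Ioi, ← lintegral_indicator measurableSet_Ioo,
      ← lintegral_const_mul _ (hk.indicator measurableSet_Ioo)]
    refine lintegral_congr fun z => ?_
    by_cases hz : 0 < z <;> by_cases hzu : z < u <;> simp [Set.indicator, hz, hzu, mul_comm]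
  rw [setLIntegral_congr_fun measurableSet_Ioi e1, setLIntegral_congr_fun measurableSet_Ioi e2]
  refine lintegral_lintegral_swap ?_
  apply Measurable.aemeasurable
  exact Measurable.ite (measurableSet_lt measurable_fst measurable_snd) (by fun_prop) measurable_const

/-- If `φ 0 * φ (x+y) ≤ φ x * φ y`, then `φ 0 * ∫ w φ(w) ≤ (∫ φ)^2`. -/
lemma first_moment {φ : ℝ → ℝ≥0∞} (hφ : Measurable φ)
    (H : ∀ x > 0, ∀ y > 0, φ 0 * φ (x + y) ≤ φ x * φ y) :
    φ 0 * ∫⁻ w in Set.Ioi (0:ℝ), φ w * ENNReal.ofReal w ≤ (∫⁻ w in Set.Ioi (0:ℝ), φ w) ^ 2 := by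
  have e := tonelli_tri (k := fun _ => 1) measurable_const hφ
  simp only [lintegral_const, one_mul, Measure.restrict_apply MeasurableSet.univ, Set.univ_inter,
    Real.volume_Ioo, sub_zero] at e
  rw [← e, sq, ← lintegral_const_mul _ (by
    exact (hφ.comp (measurable_fst.add measurable_snd)).lintegral_prod_right'),
    ← lintegral_mul_const _ hφ]
  refine setLIntegral_mono' measurableSet_Ioi fun x hx => ?_
  rw [← lintegral_const_mul _ (show Measurable fun z => φ (x + z) from
    hφ.comp (measurable_const_add x)), ← lintegral_const_mul _ hφ]
  exact setLIntegral_mono' measurableSet_Ioi fun y hy => H x hx y hy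

lemma lint_Ioo_id (u : ℝ) (hu : 0 < u) :
    ∫⁻ x in Set.Ioo (0:ℝ) u, ENNReal.ofReal x = ENNReal.ofReal (u ^ 2 / 2) := by
  rw [← ofReal_integral_eq_lintegral_ofReal]
  · rw [← integral_Ioc_eq_integral_Ioo, ← intervalIntegral.integral_of_le hu.le]
    simp
  · exact (continuous_id.integrableOn_Icc (a := 0) (b := u)).mono_set Set.Ioo_subset_Icc_self
  · filter_upwards [self_mem_ae_restrict measurableSet_Ioo] with x hx
    exact hx.1.le

lemma surv_four {g : ℝ → ℝ≥0∞} (hm : Measurable g) (hg : LC g) (x : ℝ) (hx : 0 < x)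
    (y : ℝ) (hy : 0 < y) :
    (∫⁻ u in Set.Ioi (0:ℝ), g u) * (∫⁻ u in Set.Ioi (x + y), g u) ≤
      (∫⁻ u in Set.Ioi x, g u) * (∫⁻ u in Set.Ioi y, g u) := by
  have s1 : ∫⁻ u in Set.Ioi (0:ℝ), g u = (∫⁻ u in Set.Ioc 0 x, g u) + ∫⁻ u in Set.Ioi x, g u := by
    rw [← lintegral_union measurableSet_Ioi
      (Set.disjoint_left.2 fun z hz hz' => not_lt.2 hz.2 hz'), Set.Ioc_union_Ioi_eq_Ioi hx.le]
  have s2 : ∫⁻ u in Set.Ioi y, g u = (∫⁻ u in Set.Ioc y (x + y), g u) +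
      ∫⁻ u in Set.Ioi (x + y), g u := by
    rw [← lintegral_union measurableSet_Ioi
      (Set.disjoint_left.2 fun z hz hz' => not_lt.2 hz.2 hz'),
      Set.Ioc_union_Ioi_eq_Ioi (by linarith)]
  rw [s1, s2, add_mul, mul_add, add_comm]
  have t1 : ∫⁻ u in Set.Ioi (x + y), g u = ∫⁻ u in Set.Ioi x, g (u + y) := by
    rw [← lintegral_indicator measurableSet_Ioi, ← lintegral_indicator measurableSet_Ioi,
      ← lintegral_add_right_eq_self _ y]
    refine lintegral_congr fun z => ?_
    simp [Set.indicator]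
  have t2 : ∫⁻ u in Set.Ioc y (x + y), g u = ∫⁻ u in Set.Ioc 0 x, g (u + y) := by
    rw [← lintegral_indicator measurableSet_Ioc, ← lintegral_indicator measurableSet_Ioc,
      ← lintegral_add_right_eq_self _ y]
    refine lintegral_congr fun z => ?_
    simp [Set.indicator]
  rw [add_comm]
  gcongr ?_ + _
  rw [t1, t2, mul_comm (∫⁻ u in Set.Ioi x, g u)]
  have hm' : Measurable fun u => g (u + y) := hm.comp (measurable_add_const y)
  rw [← lintegral_mul_const _ hm, ← lintegral_mul_const _ hm']
  refine setLIntegral_mono' measurableSet_Ioc fun u hu => ?_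
  rw [← lintegral_const_mul _ hm', ← lintegral_const_mul _ hm]
  refine setLIntegral_mono' measurableSet_Ioi fun v hv => ?_
  have huv : u ≤ v := hu.2.trans (le_of_lt hv)
  exact lc_four hg (by linarith) (by linarith) (by ring)

/-- `P(X>0) * E X₊^2 ≤ 2 (E X₊)^2`. -/
lemma second_moment {g : ℝ → ℝ≥0∞} (hm : Measurable g) (hg : LC g) :
    (∫⁻ u in Set.Ioi (0:ℝ), g u) * (∫⁻ u in Set.Ioi (0:ℝ), g u * ENNReal.ofReal (u ^ 2 / 2)) ≤
      (∫⁻ u in Set.Ioi (0:ℝ), g u * ENNReal.ofReal u) ^ 2 := by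
  set S : ℝ → ℝ≥0∞ := fun x => ∫⁻ z in Set.Ioi (0:ℝ), g (x + z) with hS
  have hSm : Measurable S := (hm.comp (measurable_fst.add measurable_snd)).lintegral_prod_right'
  have hSe : ∀ x, S x = ∫⁻ u in Set.Ioi x, g u := by
    intro x
    rw [hS]
    simp only
    rw [← lintegral_indicator measurableSet_Ioi, ← lintegral_indicator measurableSet_Ioi,
      ← lintegral_add_left_eq_self (fun u => (Set.Ioi x).indicator _ u) x]
    refine lintegral_congr fun z => ?_
    simp [Set.indicator]
  have h := first_moment hSm (by
    intro x hx y hy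
    simp only [hSe]
    exact surv_four hm hg x hx y hy)
  have a1 : ∫⁻ w in Set.Ioi (0:ℝ), S w = ∫⁻ u in Set.Ioi (0:ℝ), g u * ENNReal.ofReal u := by
    have e := tonelli_tri (k := fun _ => 1) measurable_const hm
    simpa only [lintegral_const, one_mul, Measure.restrict_apply MeasurableSet.univ,
      Set.univ_inter, Real.volume_Ioo, sub_zero] using e
  have a2 : ∫⁻ w in Set.Ioi (0:ℝ), S w * ENNReal.ofReal w =
      ∫⁻ u in Set.Ioi (0:ℝ), g u * ENNReal.ofReal (u ^ 2 / 2) := by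
    have e := tonelli_tri (k := fun x => ENNReal.ofReal x) ENNReal.measurable_ofReal hm
    simp only [mul_comm (S _)]
    rw [hS, e]
    refine setLIntegral_congr_fun measurableSet_Ioi fun u hu => ?_
    rw [lint_Ioo_id u hu]
  rw [a1, a2, hSe] at h
  exact h

lemma lint_split (F : ℝ → ℝ≥0∞) :
    ∫⁻ u, F u = (∫⁻ u in Set.Ioi (0:ℝ), F u) + ∫⁻ u in Set.Ioi (0:ℝ), F (-u) := by
  rw [← lintegral_add_compl F measurableSet_Ioi (A := Set.Ioi (0:ℝ))]
  congr 1
  rw [Set.compl_Ioi, setLIntegral_congr Iio_ae_eq_Iic.symm,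
    ← lintegral_indicator measurableSet_Iio, ← lintegral_indicator measurableSet_Ioi,
    ← lintegral_neg_eq_self]
  refine lintegral_congr fun z => ?_
  simp [Set.indicator]

lemma var_algebra (p q a b A B c : ℝ) (hp : 0 ≤ p) (hq : 0 ≤ q) (ha : 0 ≤ a) (hb : 0 ≤ b)
    (hpq : p + q = 1) (hA : q * A ≤ a ^ 2) (hB : p * B ≤ b ^ 2)
    (hca : c * a ≤ q ^ 2) (hcb : c * b ≤ p ^ 2) (hc : 1 < c) (hq0 : q = 0 → A = 0)
    (hp0 : p = 0 → B = 0) (hV : 1 ≤ 2 * A + 2 * B - (a - b) ^ 2) : False := by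
  have hc2 : 1 < c ^ 2 := by nlinarith
  have sA : c ^ 2 * (2 * A) ≤ (c * a) ^ 2 + (2 * q ^ 3 - q ^ 4) := by
    rcases eq_or_lt_of_le hq with h | h
    · rw [hq0 h.symm, ← h]; nlinarith [sq_nonneg (c * a)]
    · have h1 : c ^ 2 * A ≤ (c * a) ^ 2 / q := by
        rw [le_div_iff₀ h]; nlinarith [mul_le_mul_of_nonneg_left hA (sq_nonneg c)]
      have h2 : (c * a) ^ 2 ≤ q ^ 4 := by
        have : 0 ≤ c * a := by positivity
        nlinarith
      have h3 : (c * a) ^ 2 * (2 / q - 1) ≤ q ^ 4 * (2 / q - 1) := by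
        apply mul_le_mul_of_nonneg_right h2
        rw [sub_nonneg, le_div_iff₀ h]; linarith
      have h4 : q ^ 4 * (2 / q - 1) = 2 * q ^ 3 - q ^ 4 := by field_simp
      have h5 : (c * a) ^ 2 * (2 / q - 1) = 2 * ((c * a) ^ 2 / q) - (c * a) ^ 2 := by ring
      linarith
  have sB : c ^ 2 * (2 * B) ≤ (c * b) ^ 2 + (2 * p ^ 3 - p ^ 4) := by
    rcases eq_or_lt_of_le hp with h | h
    · rw [hp0 h.symm, ← h]; nlinarith [sq_nonneg (c * b)]
    · have h1 : c ^ 2 * B ≤ (c * b) ^ 2 / p := by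
        rw [le_div_iff₀ h]; nlinarith [mul_le_mul_of_nonneg_left hB (sq_nonneg c)]
      have h2 : (c * b) ^ 2 ≤ p ^ 4 := by
        have : 0 ≤ c * b := by positivity
        nlinarith
      have h3 : (c * b) ^ 2 * (2 / p - 1) ≤ p ^ 4 * (2 / p - 1) := by
        apply mul_le_mul_of_nonneg_right h2
        rw [sub_nonneg, le_div_iff₀ h]; linarith
      have h4 : p ^ 4 * (2 / p - 1) = 2 * p ^ 3 - p ^ 4 := by field_simp
      have h5 : (c * b) ^ 2 * (2 / p - 1) = 2 * ((c * b) ^ 2 / p) - (c * b) ^ 2 := by ring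
      linarith
  have sAB : (c * a) * (c * b) ≤ q ^ 2 * p ^ 2 := mul_le_mul hca hcb (by positivity) (by positivity)
  have hfin : 2 * q ^ 3 - q ^ 4 + (2 * p ^ 3 - p ^ 4) + 2 * (q ^ 2 * p ^ 2) = 1 - 2 * (p * q) := by
    have : p = 1 - q := by linarith
    subst this; ring
  have : c ^ 2 * (2 * A + 2 * B - (a - b) ^ 2) ≤ 1 := by
    nlinarith [mul_nonneg hp hq]
  nlinarith

lemma lc_shift {g : ℝ → ℝ≥0∞} (hg : LC g) (x0 : ℝ) : LC (fun u => g (u + x0)) := by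
  intro x y t h0 h1
  refine (hg (x + x0) (y + x0) t h0 h1).trans (le_of_eq ?_)
  congr 1; simp only [smul_eq_mul]; ring

lemma lc_neg {g : ℝ → ℝ≥0∞} (hg : LC g) : LC (fun u => g (-u)) := by
  intro x y t h0 h1
  refine (hg (-x) (-y) t h0 h1).trans (le_of_eq ?_)
  congr 1; simp only [smul_eq_mul]; ring

/-- A one-dimensional logconcave density with variance at least one is at most one. -/
lemma density_le_one {Ω : Type*} [MeasurableSpace Ω] (μ : Measure Ω) [IsProbabilityMeasure μ]
    (X : Ω → ℝ) (hXm : Measurable X) (hX : MemLp X 2 μ) (hV : 1 ≤ variance X μ)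
    (g : ℝ → ℝ≥0∞) (hm : Measurable g) (hg : LC g)
    (hd : ∀ ψ : ℝ → ℝ≥0∞, Measurable ψ → ∫⁻ ω, ψ (X ω) ∂μ = ∫⁻ u, ψ u * g u) (x0 : ℝ) :
    g x0 ≤ 1 := by
  by_contra hcon
  push Not at hcon
  obtain ⟨c, hc1, hc2⟩ := ENNReal.lt_iff_exists_nnreal_btwn.1 hcon
  set g1 : ℝ → ℝ≥0∞ := fun u => g (u + x0) with hg1
  set g2 : ℝ → ℝ≥0∞ := fun u => g1 (-u) with hg2
  have hm1 : Measurable g1 := hm.comp (measurable_add_const x0)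
  have hm2 : Measurable g2 := hm1.comp measurable_neg
  have hL1 : LC g1 := lc_shift hg x0
  have hL2 : LC g2 := lc_neg hL1
  set Y : Ω → ℝ := fun ω => X ω - x0 with hY
  have hYm : Measurable Y := hXm.sub_const x0
  have hY2 : MemLp Y 2 μ := hX.sub (memLp_const x0)
  have hVY : 1 ≤ variance Y μ := by
    rw [hY, variance_sub_const hXm.aestronglyMeasurable]; exact hV
  have hdY : ∀ ψ : ℝ → ℝ≥0∞, Measurable ψ → ∫⁻ ω, ψ (Y ω) ∂μ =
      (∫⁻ u in Set.Ioi (0:ℝ), g1 u * ψ u) + ∫⁻ u in Set.Ioi (0:ℝ), g2 u * ψ (-u) := by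
    intro ψ hψ
    rw [← lint_split (fun u => g1 u * ψ u)]
    rw [hd (fun u => ψ (u - x0)) (hψ.comp (measurable_sub_const x0)),
      ← lintegral_add_right_eq_self _ x0]
    refine lintegral_congr fun u => ?_
    simp [hg1, mul_comm]
  have mom : ∀ g : ℝ → ℝ≥0∞, Measurable g → LC g → (c:ℝ≥0∞) ≤ g 0 →
      c * (∫⁻ w in Set.Ioi (0:ℝ), g w * ENNReal.ofReal w) ≤ (∫⁻ w in Set.Ioi (0:ℝ), g w) ^ 2 := by
    intro g hm hg hc
    refine le_trans ?_ (first_moment hm fun x hx y hy =>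
      lc_four hg (by linarith [hx.lt]) (by linarith [hy.lt]) (by ring))
    gcongr
  set q := ∫⁻ w in Set.Ioi (0:ℝ), g1 w with hq
  set p := ∫⁻ w in Set.Ioi (0:ℝ), g2 w with hp
  set a := ∫⁻ w in Set.Ioi (0:ℝ), g1 w * ENNReal.ofReal w with ha
  set b := ∫⁻ w in Set.Ioi (0:ℝ), g2 w * ENNReal.ofReal w with hb
  set A := ∫⁻ w in Set.Ioi (0:ℝ), g1 w * ENNReal.ofReal (w ^ 2 / 2) with hA
  set B := ∫⁻ w in Set.Ioi (0:ℝ), g2 w * ENNReal.ofReal (w ^ 2 / 2) with hB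
  have m1 : c * a ≤ q ^ 2 := mom g1 hm1 hL1 (by simpa [hg1] using hc2.le)
  have m2 : c * b ≤ p ^ 2 := mom g2 hm2 hL2 (by simpa [hg2, hg1] using hc2.le)
  have n1 : q * A ≤ a ^ 2 := second_moment hm1 hL1
  have n2 : p * B ≤ b ^ 2 := second_moment hm2 hL2
  have zero_case : ∀ (g : ℝ → ℝ≥0∞) (h : ℝ → ℝ≥0∞), Measurable g →
      ∫⁻ w in Set.Ioi (0:ℝ), g w = 0 → ∫⁻ w in Set.Ioi (0:ℝ), g w * h w = 0 := by
    intro g h hm h0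
    rw [lintegral_eq_zero_iff hm] at h0
    refine lintegral_eq_zero_of_ae_eq_zero ?_
    filter_upwards [h0] with w hw
    simp only [Pi.zero_apply] at hw ⊢
    rw [hw, zero_mul]
  have hpq : q + p = 1 := by
    have := hdY (fun _ => 1) measurable_const
    simp only [mul_one, lintegral_const, measure_univ] at this
    exact this.symm
  have hint2 : Integrable (fun ω => Y ω ^ 2) μ := hY2.integrable_sq
  have hint1 : Integrable Y μ := hY2.integrable (by norm_num)
  have eAB : ∫⁻ ω, ENNReal.ofReal (Y ω ^ 2 / 2) ∂μ = A + B := by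
    have := hdY (fun u => ENNReal.ofReal (u ^ 2 / 2)) (by fun_prop)
    simpa using this
  have ea : ∫⁻ ω, ENNReal.ofReal (Y ω) ∂μ = a := by
    have := hdY (fun u => ENNReal.ofReal u) (by fun_prop)
    rw [this]
    have z : ∫⁻ u in Set.Ioi (0:ℝ), g2 u * ENNReal.ofReal (-u) = 0 := by
      rw [setLIntegral_congr_fun (g := fun _ => 0) measurableSet_Ioi]
      · simp
      · intro u hu
        simp [ENNReal.ofReal_of_nonpos (show -u ≤ 0 by linarith [hu.out.le])]
    rw [z, add_zero]
  have eb : ∫⁻ ω, ENNReal.ofReal (- Y ω) ∂μ = b := by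
    have := hdY (fun u => ENNReal.ofReal (-u)) (by fun_prop)
    rw [this]
    have z : ∫⁻ u in Set.Ioi (0:ℝ), g1 u * ENNReal.ofReal (-u) = 0 := by
      rw [setLIntegral_congr_fun (g := fun _ => 0) measurableSet_Ioi]
      · simp
      · intro u hu
        simp [ENNReal.ofReal_of_nonpos (show -u ≤ 0 by linarith [hu.out.le])]
    simp only [neg_neg]
    rw [z, zero_add]
  have hABT : A + B ≠ ⊤ := by
    rw [← eAB]
    exact (hint2.div_const 2).lintegral_lt_top.ne
  have hAT : A ≠ ⊤ := fun h => hABT (by simp [h])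
  have hBT : B ≠ ⊤ := fun h => hABT (by simp [h])
  have haT : a ≠ ⊤ := by rw [← ea]; exact hint1.lintegral_lt_top.ne
  have hbT : b ≠ ⊤ := by rw [← eb]; exact hint1.neg.lintegral_lt_top.ne
  have hqT : q ≠ ⊤ := fun h => by simp [h] at hpq
  have hpT : p ≠ ⊤ := fun h => by simp [h] at hpq
  have hEY : ∫ ω, Y ω ∂μ = a.toReal - b.toReal := by
    rw [integral_eq_lintegral_pos_part_sub_lintegral_neg_part hint1, ea, eb]
  have hEY2 : ∫ ω, Y ω ^ 2 ∂μ = 2 * A.toReal + 2 * B.toReal := by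
    have : ∫ ω, Y ω ^ 2 / 2 ∂μ = (A + B).toReal := by
      rw [integral_eq_lintegral_of_nonneg_ae (by filter_upwards with ω; simp; positivity)
        (hint2.div_const 2).aestronglyMeasurable, eAB]
    rw [integral_div, ENNReal.toReal_add hAT hBT] at this
    linarith
  rw [variance_eq_sub hY2] at hVY
  simp only [Pi.pow_apply] at hVY
  rw [hEY, hEY2] at hVY
  have tr : ∀ x y : ℝ≥0∞, y ≠ ⊤ → x ≤ y → x.toReal ≤ y.toReal := fun x y hy h =>
    ENNReal.toReal_mono hy h
  refine var_algebra p.toReal q.toReal a.toReal b.toReal A.toReal B.toReal c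
    toReal_nonneg toReal_nonneg toReal_nonneg toReal_nonneg ?_ ?_ ?_ ?_ ?_ ?_ ?_ ?_ hVY
  · rw [← ENNReal.toReal_add hpT hqT, add_comm, hpq]; simp
  · simpa using tr _ _ (by finiteness) n1
  · simpa using tr _ _ (by finiteness) n2
  · simpa using tr _ _ (by finiteness) m1
  · simpa using tr _ _ (by finiteness) m2
  · exact_mod_cast hc1
  · intro h
    have h0 : q = 0 := by
      rcases (ENNReal.toReal_eq_zero_iff _).1 h with h | h
      · exact h
      · exact absurd h hqT
    rw [hA, zero_case g1 _ hm1 h0]; simp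
  · intro h
    have h0 : p = 0 := by
      rcases (ENNReal.toReal_eq_zero_iff _).1 h with h | h
      · exact h
      · exact absurd h hpT
    rw [hB, zero_case g2 _ hm2 h0]; simp

lemma lint_exp_abs (t : ℝ) (ht : 0 < t) :
    ∫⁻ u : ℝ, ENNReal.ofReal (Real.exp (-t * |u|)) = ENNReal.ofReal (2 / t) := by
  have h1 : ∫⁻ u in Set.Ioi (0:ℝ), ENNReal.ofReal (Real.exp (-t * |u|)) = ENNReal.ofReal (1 / t) := by
    have e : ∫⁻ u in Set.Ioi (0:ℝ), ENNReal.ofReal (Real.exp (-t * |u|)) =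
        ∫⁻ u in Set.Ioi (0:ℝ), ENNReal.ofReal (Real.exp (-t * u)) := by
      refine setLIntegral_congr_fun measurableSet_Ioi fun u hu => ?_
      simp only [abs_of_pos hu.out]
    rw [e, ← ofReal_integral_eq_lintegral_ofReal]
    · rw [integral_exp_mul_Ioi (by linarith)]
      congr 1
      simp [neg_div_neg_eq]
    · exact integrableOn_exp_mul_Ioi (by linarith) 0
    · filter_upwards with u using (Real.exp_pos _).le
  rw [lint_split]
  simp only [abs_neg]
  rw [h1, ← ENNReal.ofReal_add (by positivity) (by positivity)]
  congr 1; ring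

lemma meas_version {d : ℕ} (f : (Fin d → ℝ) → ℝ) (h0 : ∀ x, 0 ≤ f x)
    (hlc : ∀ x y : Fin d → ℝ, ∀ t : ℝ, 0 ≤ t → t ≤ 1 →
      f x ^ t * f y ^ (1 - t) ≤ f (t • x + (1 - t) • y)) :
    ∃ F : (Fin d → ℝ) → ℝ≥0∞, Measurable F ∧ LC F ∧
      (fun x => ENNReal.ofReal (f x)) =ᵐ[volume] F := by
  set C : Set (Fin d → ℝ) := {x | 0 < f x} with hC
  have hpos : ∀ x ∈ C, ∀ y ∈ C, ∀ t : ℝ, 0 ≤ t → t ≤ 1 → t • x + (1 - t) • y ∈ C := by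
    intro x hx y hy t ht0 ht1
    exact lt_of_lt_of_le (mul_pos (Real.rpow_pos_of_pos hx _) (Real.rpow_pos_of_pos hy _))
      (hlc x y t ht0 ht1)
  have hconv : Convex ℝ C := by
    intro x hx y hy a b ha hb hab
    have : b = 1 - a := by linarith
    subst this
    exact hpos x hx y hy a ha (by linarith)
  have hconc : ConcaveOn ℝ C (fun x => Real.log (f x)) := by
    refine ⟨hconv, ?_⟩
    intro x hx y hy a b ha hb hab
    have : b = 1 - a := by linarith
    subst this
    have hx' : 0 < f x := hx
    have hy' : 0 < f y := hy
    have := Real.log_le_log (mul_pos (Real.rpow_pos_of_pos hx' a) (Real.rpow_pos_of_pos hy' (1 - a)))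
      (hlc x y a ha (by linarith))
    rw [Real.log_mul (Real.rpow_pos_of_pos hx' _).ne' (Real.rpow_pos_of_pos hy' _).ne',
      Real.log_rpow hx', Real.log_rpow hy'] at this
    simpa using this
  have hcont : ContinuousOn (fun x => ENNReal.ofReal (f x)) (interior C) := by
    have h1 := hconc.continuousOn_interior
    have h2 : ContinuousOn f (interior C) := by
      refine (Real.continuous_exp.comp_continuousOn h1).congr ?_
      intro x hx
      exact (Real.exp_log (interior_subset hx : x ∈ C)).symm
    exact ENNReal.continuous_ofReal.comp_continuousOn h2
  classical
  refine ⟨(interior C).indicator (fun x => ENNReal.ofReal (f x)), ?_, ?_, ?_⟩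
  · have := ContinuousOn.measurable_piecewise hcont (g := fun _ => (0:ℝ≥0∞)) continuousOn_const
      isOpen_interior.measurableSet
    exact (Set.piecewise_eq_indicator (s := interior C) (f := fun x => ENNReal.ofReal (f x))) ▸ this
  · intro x y t ht0 ht1
    have h1t : 0 < 1 - t := by linarith
    by_cases hx : x ∈ interior C
    · by_cases hy : y ∈ interior C
      · have hxy : t • x + (1 - t) • y ∈ interior C :=
          hconv.interior hx hy ht0.le h1t.le (by ring)
        rw [Set.indicator_of_mem hx, Set.indicator_of_mem hy, Set.indicator_of_mem hxy,
          ENNReal.ofReal_rpow_of_nonneg (h0 _) ht0.le, ENNReal.ofReal_rpow_of_nonneg (h0 _) h1t.le,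
          ← ENNReal.ofReal_mul (Real.rpow_nonneg (h0 _) _)]
        exact ENNReal.ofReal_le_ofReal (hlc x y t ht0.le ht1.le)
      · rw [Set.indicator_of_notMem hy, ENNReal.zero_rpow_of_pos h1t]; simp
    · rw [Set.indicator_of_notMem hx, ENNReal.zero_rpow_of_pos ht0]; simp
  · have hfr : volume (frontier C) = 0 := hconv.addHaar_frontier volume
    have : ∀ᵐ x, x ∉ frontier C := measure_eq_zero_iff_ae_notMem.1 hfr
    filter_upwards [this] with x hx
    by_cases hi : x ∈ interior C
    · rw [Set.indicator_of_mem hi]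
    · rw [Set.indicator_of_notMem hi]
      have : x ∉ C := fun h => hx ⟨subset_closure h, hi⟩
      exact ENNReal.ofReal_of_nonpos (not_lt.1 this)

lemma lint_affine (h : ℝ → ℝ≥0∞) (hh : Measurable h) (a L : ℝ) (ha : a ≠ 0) :
    ∫⁻ s, h s = ENNReal.ofReal |a|⁻¹ * ∫⁻ u, h ((u - L) / a) := by
  rw [lintegral_sub_right_eq_self (fun u => h (u / a)) L]
  have := Real.map_volume_mul_left (a := a⁻¹) (inv_ne_zero ha)
  have e : ∫⁻ u, h (u / a) = ∫⁻ s, h s ∂(Measure.map (a⁻¹ * ·) volume) := by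
    rw [lintegral_map hh (measurable_const_mul _)]
    simp [div_eq_inv_mul]
  rw [e, this, lintegral_smul_measure, inv_inv, smul_eq_mul, ← mul_assoc,
    ← ENNReal.ofReal_mul (by positivity), inv_mul_cancel₀ (by positivity)]
  simp

lemma marginal_density {k : ℕ} (μ : Measure (Fin (k + 1) → ℝ)) (hμ : IsLogConcave μ)
    (θ : Fin (k + 1) → ℝ) (j : Fin (k + 1)) (hj : θ j ≠ 0) :
    ∃ g : ℝ → ℝ≥0∞, Measurable g ∧ LC g ∧ ∀ ψ : ℝ → ℝ≥0∞, Measurable ψ →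
      ∫⁻ x, ψ (∑ i, x i * θ i) ∂μ = ∫⁻ u, ψ u * g u := by
  obtain ⟨f, h0, hμf, hlc⟩ := hμ
  obtain ⟨F, hFm, hFL, hFe⟩ := meas_version f h0 hlc
  rw [withDensity_congr_ae hFe] at hμf
  subst hμf
  set L : (Fin k → ℝ) → ℝ := fun x => ∑ i, x i * θ (j.succAbove i) with hL
  have hLm : Measurable L := by fun_prop
  set T : (Fin k → ℝ) × ℝ → (Fin (k + 1) → ℝ) := fun p => j.insertNth ((p.2 - L p.1) / θ j) p.1 with hT
  have hTm : Measurable T := (measurable_insertNth k j).comp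
    (((measurable_snd.sub (hLm.comp measurable_fst)).div_const _).prodMk measurable_fst)
  have hTlin : ∀ p q : (Fin k → ℝ) × ℝ, ∀ t : ℝ, T (t • p + (1 - t) • q) = t • T p + (1 - t) • T q := by
    intro p q t
    ext i
    refine Fin.succAboveCases j ?_ (fun i => ?_) i
    · simp only [hT, hL, Fin.insertNth_apply_same, Prod.fst_add, Prod.snd_add, Prod.smul_fst,
        Prod.smul_snd, Pi.add_apply, Pi.smul_apply, smul_eq_mul, add_mul, Finset.sum_add_distrib,
        mul_assoc, ← Finset.mul_sum]
      ring
    · simp [hT]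
  set c : ℝ≥0∞ := ENNReal.ofReal |θ j|⁻¹ with hc
  have hGm : Measurable fun u : ℝ => ∫⁻ x : Fin k → ℝ, F (T (x, u)) :=
    (hFm.comp hTm).lintegral_prod_left'
  have hGL : LC fun u : ℝ => ∫⁻ x : Fin k → ℝ, F (T (x, u)) := by
    refine lc_marginal k (fun p => F (T p)) (hFm.comp hTm) ?_
    intro p q t ht0 ht1
    simp only
    rw [hTlin]
    exact hFL _ _ t ht0 ht1
  refine ⟨fun u => c * ∫⁻ x : Fin k → ℝ, F (T (x, u)), hGm.const_mul c, ?_, ?_⟩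
  · intro x y t ht0 ht1
    have h1t : 0 < 1 - t := by linarith
    simp only
    rw [ENNReal.mul_rpow_of_nonneg _ _ ht0.le, ENNReal.mul_rpow_of_nonneg _ _ h1t.le]
    have q : c = c ^ t * c ^ (1 - t) := by
      rw [← ENNReal.rpow_add_of_nonneg _ _ ht0.le h1t.le]; simp
    conv_rhs => rw [q]
    calc _ = c ^ t * c ^ (1 - t) * ((∫⁻ z : Fin k → ℝ, F (T (z, x))) ^ t *
            (∫⁻ z : Fin k → ℝ, F (T (z, y))) ^ (1 - t)) := by ring
      _ ≤ _ := by gcongr; exact hGL x y t ht0 ht1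
  · intro ψ hψ
    have hlin : Measurable fun x : Fin (k + 1) → ℝ => ∑ i, x i * θ i := by fun_prop
    have hcm : Measurable fun x : Fin (k + 1) → ℝ => ψ (∑ i, x i * θ i) := hψ.comp hlin
    rw [lintegral_withDensity_eq_lintegral_mul _ hFm hcm]
    rw [lintegral_fin_succ k j _ (hFm.mul hcm)]
    have inner : ∀ x : Fin k → ℝ, ∫⁻ s : ℝ, (F * (fun x : Fin (k + 1) → ℝ => ψ (∑ i, x i * θ i))) (j.insertNth s x) =
        c * ∫⁻ u, ψ u * F (T (x, u)) := by
      intro x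
      rw [lint_affine _ _ (θ j) (L x) hj]
      · congr 1
        refine lintegral_congr fun u => ?_
        simp only [Pi.mul_apply]
        rw [mul_comm]
        congr 2
        rw [Fin.sum_univ_succAbove _ j]
        simp only [Fin.insertNth_apply_same, Fin.insertNth_apply_succAbove]
        rw [div_mul_cancel₀ _ hj, hL]; ring
      · exact (hFm.mul hcm).comp ((measurable_insertNth k j).comp
          (measurable_id.prodMk measurable_const))
    rw [lintegral_congr inner]
    have hm2 : Measurable fun p : (Fin k → ℝ) × ℝ => ψ p.2 * F (T p) :=
      (hψ.comp measurable_snd).mul (hFm.comp hTm)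
    rw [lintegral_const_mul _ hm2.lintegral_prod_right', lintegral_lintegral_swap hm2.aemeasurable,
      ← lintegral_const_mul _ hm2.lintegral_prod_left']
    refine lintegral_congr fun u => ?_
    simp only
    rw [lintegral_const_mul _ (show Measurable fun x : Fin k → ℝ => F (T (x, u)) from
      hFm.comp (hTm.comp (measurable_id.prodMk measurable_const)))]
    ring

lemma cov_memLp {k : ℕ} (μ : Measure (Fin k → ℝ)) [IsProbabilityMeasure μ] (hμ : HasIdCovariance μ)
    (i : Fin k) : MemLp (fun x : Fin k → ℝ => x i) 2 μ := by
  rw [memLp_two_iff_integrable_sq (measurable_pi_apply i).aestronglyMeasurable]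
  by_contra h
  have := hμ i i
  rw [integral_undef (by simpa [sq] using h)] at this
  simp at this
  nlinarith [mul_self_nonneg (∫ x, x i ∂μ)]

lemma var_ge {k : ℕ} (μ : Measure (Fin k → ℝ)) [IsProbabilityMeasure μ] (hμ : HasIdCovariance μ)
    (θ : Fin k → ℝ) :
    MemLp (fun x : Fin k → ℝ => ∑ i, x i * θ i) 2 μ ∧
    variance (fun x : Fin k → ℝ => ∑ i, x i * θ i) μ = ∑ i, θ i ^ 2 := by
  have hm : ∀ i, MemLp (fun x : Fin k → ℝ => x i * θ i) 2 μ := fun i =>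
    (cov_memLp μ hμ i).mul_const (θ i)
  have e : (fun x : Fin k → ℝ => ∑ i, x i * θ i) = ∑ i, fun x : Fin k → ℝ => x i * θ i := by
    ext x; simp
  constructor
  · exact memLp_finsetSum _ fun i _ => hm i
  · rw [e, variance_sum' fun i _ => hm i]
    have : ∀ i j : Fin k, cov[fun x : Fin k → ℝ => x i * θ i, fun x : Fin k → ℝ => x j * θ j; μ] =
        if i = j then θ i ^ 2 else 0 := by
      intro i j
      rw [covariance_mul_const_left, covariance_mul_const_right,
        covariance_eq_sub (cov_memLp μ hμ i) (cov_memLp μ hμ j)]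
      have := hμ i j
      simp only [Pi.mul_apply]
      rw [this]
      split_ifs with h
      · subst h; ring
      · ring
    simp [this]

/-- The key exponential moment bound. -/
lemma exp_moment {k : ℕ} (μ : Measure (Fin (k + 1) → ℝ)) [IsProbabilityMeasure μ]
    (hlc : IsLogConcave μ) (hμ : HasIdCovariance μ)
    (θ : Fin (k + 1) → ℝ) (j : Fin (k + 1)) (hj : 1 ≤ |θ j|) (t : ℝ) (ht : 0 < t) :
    ∫⁻ x, ENNReal.ofReal (Real.exp (-t * |∑ i, x i * θ i|)) ∂μ ≤ ENNReal.ofReal (2 / t) := by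
  have hj0 : θ j ≠ 0 := by
    intro h; rw [h] at hj; norm_num at hj
  obtain ⟨g, hgm, hgL, hd⟩ := marginal_density μ hlc θ j hj0
  obtain ⟨hX, hV⟩ := var_ge μ hμ θ
  have hV1 : 1 ≤ variance (fun x : Fin (k + 1) → ℝ => ∑ i, x i * θ i) μ := by
    rw [hV]
    calc (1:ℝ) ≤ |θ j| ^ 2 := by nlinarith
      _ = θ j ^ 2 := sq_abs _
      _ ≤ _ := Finset.single_le_sum (f := fun i => θ i ^ 2) (fun i _ => sq_nonneg _) (Finset.mem_univ j)
  have hg1 := density_le_one μ _ (by fun_prop) hX hV1 g hgm hgL hd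
  rw [hd (fun u => ENNReal.ofReal (Real.exp (-t * |u|))) (by fun_prop), ← lint_exp_abs t ht]
  refine lintegral_mono fun u => ?_
  calc _ ≤ ENNReal.ofReal (Real.exp (-t * |u|)) * 1 := by gcongr; exact hg1 u
    _ = _ := by simp

lemma lint_pi_prod {ι : Type*} [Fintype ι] {E : Type*} [MeasurableSpace E] (μ : ι → Measure E)
    [∀ i, IsProbabilityMeasure (μ i)] (K : ι → E → ℝ≥0∞) (hK : ∀ i, Measurable (K i)) :
    ∫⁻ b, ∏ i, K i (b i) ∂(Measure.pi μ) = ∏ i, ∫⁻ w, K i w ∂(μ i) := by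
  have h := iIndepFun_pi (μ := μ) (X := K) (fun i => (hK i).aemeasurable)
  rw [lintegral_prod_eq_prod_lintegral_of_indepFun Finset.univ (fun i (b : ι → E) => K i (b i)) h
    (fun i => (hK i).comp (measurable_pi_apply i))]
  refine Finset.prod_congr rfl fun i _ => ?_
  exact (measurePreserving_eval μ i).lintegral_comp (hK i)

lemma fubini_bound {n : ℕ} {E Z : Type*} [Inhabited E] [MeasurableSpace E] [MeasurableSpace Z]
    (μ : Fin n → Measure E) [∀ i, IsProbabilityMeasure (μ i)] (I : Finset (Fin n))
    (φ : (Fin n → E) → Z) (hφ : Measurable φ)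
    (hdep : ∀ W W' : Fin n → E, (∀ i ∈ I, W i = W' i) → φ W = φ W')
    (H : Z → E → ℝ≥0∞) (hH : Measurable (fun p : Z × E => H p.1 p.2)) (C : ℝ≥0∞)
    (hC : ∀ z i, ∫⁻ w, H z w ∂(μ i) ≤ C) :
    ∫⁻ W, ∏ i ∈ Iᶜ, H (φ W) (W i) ∂(Measure.pi μ) ≤ C ^ (Iᶜ).card := by
  have mp := (measurePreserving_piEquivPiSubtypeProd μ (fun i => i ∈ I)).symm
  set e := (MeasurableEquiv.piEquivPiSubtypeProd (fun _ : Fin n => E) (fun i => i ∈ I)).symm with he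
  have hm : Measurable fun W : Fin n → E => ∏ i ∈ Iᶜ, H (φ W) (W i) := by
    refine Finset.measurable_prod _ fun i _ => ?_
    exact hH.comp (hφ.prodMk (measurable_pi_apply i))
  rw [← mp.lintegral_comp hm, lintegral_prod (fun a => ∏ i ∈ Iᶜ, H (φ (e a)) (e a i))
    (hm.comp e.measurable).aemeasurable]
  have inner : ∀ a, ∫⁻ b, ∏ i ∈ Iᶜ, H (φ (e (a, b))) (e (a, b) i)
      ∂(Measure.pi fun i : {i // i ∉ I} => μ i) ≤ C ^ (Iᶜ).card := by
    intro a
    set z := φ (e (a, fun _ => default)) with hz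
    have h1 : ∀ b, ∏ i ∈ Iᶜ, H (φ (e (a, b))) (e (a, b) i) =
        ∏ i : {i // i ∉ I}, H z (b i) := by
      intro b
      have hzz : φ (e (a, b)) = z := by
        apply hdep
        intro i hi
        simp [he, MeasurableEquiv.piEquivPiSubtypeProd, Equiv.piEquivPiSubtypeProd, hi]
      rw [hzz, ← Finset.prod_subtype (p := fun i => i ∉ I) (f := fun i => H z (e (a, b) i)) Iᶜ
        (by simp) |>.symm]
      refine Finset.prod_congr rfl fun i _ => ?_
      simp [he, MeasurableEquiv.piEquivPiSubtypeProd, Equiv.piEquivPiSubtypeProd, i.2]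
    rw [lintegral_congr h1, lint_pi_prod (fun i : {i // i ∉ I} => μ i) (fun _ => H z)
      (fun _ => hH.comp (measurable_const.prodMk measurable_id))]
    refine (Finset.prod_le_prod' (s := Finset.univ) (g := fun _ => C)
      fun (i : {i // i ∉ I}) _ => hC z i.1).trans ?_
    rw [Finset.prod_const]
    refine le_of_eq ?_
    congr 1
    rw [Finset.card_univ, Fintype.card_subtype]
    congr 1; ext i; simp
  refine (lintegral_mono fun a => inner a).trans ?_
  simp

lemma max_vol {ι : Type*} [Fintype ι] {d : ℕ} (v : ι → Fin d → ℝ) (S : Set ι) (e : Fin d → ι)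
    (heS : ∀ j, e j ∈ S) (he : ∀ j, v (e j) = Pi.single j 1) :
    ∃ B : Fin d → ι, (∀ r, B r ∈ S) ∧ (Matrix.of (fun r => v (B r))).det ≠ 0 ∧
      ∀ i ∈ S, ∃ a : Fin d → ℝ, (∀ r, |a r| ≤ 1) ∧ v i = ∑ r, a r • v (B r) := by
  classical
  have hfin : {B : Fin d → ι | ∀ r, B r ∈ S}.Finite := Set.toFinite _
  obtain ⟨B, hB, hmax⟩ := Set.exists_max_image _
    (fun B : Fin d → ι => |(Matrix.of (fun r => v (B r))).det|) hfin ⟨e, heS⟩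
  have hone : (Matrix.of (fun r => v (e r))) = 1 := by
    ext i j
    simp [he, Matrix.one_apply, Pi.single_apply, eq_comm]
  have hdet : (Matrix.of (fun r => v (B r))).det ≠ 0 := by
    have := hmax e heS
    simp only [hone, Matrix.det_one, abs_one] at this
    exact abs_pos.mp (lt_of_lt_of_le one_pos this)
  refine ⟨B, hB, hdet, fun i hi => ?_⟩
  set M := Matrix.of (fun r => v (B r)) with hM
  refine ⟨fun r => M.det⁻¹ * Matrix.cramer M.transpose (v i) r, fun r => ?_, ?_⟩
  · beta_reduce
    rw [Matrix.cramer_transpose_apply, abs_mul, abs_inv, inv_mul_le_one₀ (abs_pos.mpr hdet)]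
    have h1 : M.updateRow r (v i) = Matrix.of (fun r' => v (Function.update B r i r')) := by
      ext a b
      by_cases h : a = r
      · subst h; simp
      · simp [h, hM, Matrix.updateRow_ne]
    rw [h1]
    refine hmax (Function.update B r i) fun r' => ?_
    by_cases h : r' = r
    · subst h; simpa using hi
    · simpa [h] using hB r'
  · have h2 := Matrix.mulVec_cramer M.transpose (v i)
    rw [Matrix.det_transpose] at h2
    ext j
    have h3 := congrFun h2 j
    simp only [Matrix.mulVec, dotProduct, Matrix.transpose_apply, Pi.smul_apply, smul_eq_mul] at h3
    simp only [Finset.sum_apply, Pi.smul_apply, smul_eq_mul]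
    have h4 : v i j = M.det⁻¹ * (M.det * v i j) := by field_simp
    rw [h4, ← h3, Finset.mul_sum]
    refine Finset.sum_congr rfl fun r _ => ?_
    rw [hM, Matrix.of_apply]
    ring

/-- rows of `W` together with the unit vectors -/
noncomputable def rowv {n d : ℕ} (W : Fin n → Fin d → ℝ) : Fin n ⊕ Fin d → Fin d → ℝ :=
  Sum.elim W (fun j => Pi.single j 1)

/-- net point determined by the basis rows `B` and rounded values `k` -/
noncomputable def netp {n d : ℕ} (N : ℕ) (ε : ℝ) (B : Fin d → Fin n ⊕ Fin d)
    (k : Fin d → Fin (2 * N + 1)) (W : Fin n → Fin d → ℝ) : Fin d → ℝ :=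
  (Matrix.of (fun r => rowv W (B r))).det⁻¹ •
    ((Matrix.of (fun r => rowv W (B r))).adjugate.mulVec
      (fun r => ε * (((k r : ℕ) : ℝ) - N)))

lemma netp_measurable {n d : ℕ} (N : ℕ) (ε : ℝ) (B : Fin d → Fin n ⊕ Fin d)
    (k : Fin d → Fin (2 * N + 1)) : Measurable (netp N ε B k) := by
  have hc : Continuous fun W : Fin n → Fin d → ℝ => Matrix.of (fun r => rowv W (B r)) := by
    refine continuous_matrix fun i j => ?_
    simp only [Matrix.of_apply]
    unfold rowv
    rcases B i with a | a
    · simp only [Sum.elim_inl]; fun_prop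
    · simp only [Sum.elim_inr]; fun_prop
  have h1 : Measurable fun W : Fin n → Fin d → ℝ =>
    (Matrix.of (fun r => rowv W (B r))).det := (hc.matrix_det).measurable
  have h2 : Measurable fun W : Fin n → Fin d → ℝ => 
    ((Matrix.of (fun r => rowv W (B r))).adjugate.mulVec
      (fun r => ε * (((k r : ℕ) : ℝ) - N))) := 
    (hc.matrix_adjugate.matrix_mulVec continuous_const).measurable
  unfold netp
  exact h1.inv.smul h2

lemma netp_dep {n d : ℕ} (N : ℕ) (ε : ℝ) (B : Fin d → Fin n ⊕ Fin d)
    (k : Fin d → Fin (2 * N + 1)) (W W' : Fin n → Fin d → ℝ)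
    (h : ∀ i, (∃ r, B r = Sum.inl i) → W i = W' i) : netp N ε B k W = netp N ε B k W' := by
  have : (fun r => rowv W (B r)) = (fun r => rowv W' (B r)) := by
    funext r
    unfold rowv
    rcases hr : B r with a | a
    · simpa using h a ⟨r, hr⟩
    · simp
  unfold netp
  rw [this]

lemma net_exists {n d : ℕ} (W : Fin n → Fin d → ℝ) (θ : Fin d → ℝ) (ε T : ℝ) (N : ℕ)
    (hε : 0 < ε) (hT : T ≤ ε * N) (hθ : ∀ j, |θ j| ≤ T) :
    ∃ (B : Fin d → Fin n ⊕ Fin d) (k : Fin d → Fin (2 * N + 1)), ∀ i,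
      |∑ j, rowv W i j * θ j| ≤ T →
      |∑ j, rowv W i j * netp N ε B k W j - ∑ j, rowv W i j * θ j| ≤ d * ε := by
  obtain ⟨B, hB, hdet, hspan⟩ := max_vol (rowv W) {i | |∑ j, rowv W i j * θ j| ≤ T} Sum.inr
    (by intro j; simpa [rowv, Pi.single_apply] using hθ j) (by intro j; rfl)
  set y : Fin d → ℝ := fun r => ∑ j, rowv W (B r) j * θ j with hy
  have hyT : ∀ r, |y r| ≤ T := fun r => hB r
  have hfl : ∀ r, 0 ≤ ⌊y r / ε⌋ + N ∧ ⌊y r / ε⌋ + N ≤ 2 * N := by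
    intro r
    have h := abs_le.mp ((hyT r).trans hT)
    constructor
    · have : -(N : ℤ) ≤ ⌊y r / ε⌋ := by
        rw [Int.le_floor]; push_cast; rw [le_div_iff₀ hε]; linarith
      linarith
    · have : ⌊y r / ε⌋ ≤ (N : ℤ) := by
        have h1 : y r / ε ≤ N := by rw [div_le_iff₀ hε]; linarith
        have := (Int.floor_le (y r / ε)).trans h1
        exact_mod_cast this
      linarith
  refine ⟨B, fun r => ⟨(⌊y r / ε⌋ + N).toNat, by have := hfl r; omega⟩, fun i hi => ?_⟩
  set k : Fin d → Fin (2 * N + 1) := fun r => ⟨(⌊y r / ε⌋ + N).toNat, by have := hfl r; omega⟩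
    with hk
  have hkv : ∀ r, (((k r : ℕ) : ℝ) - N) = ⌊y r / ε⌋ := by
    intro r
    have : (((⌊y r / ε⌋ + N).toNat : ℤ)) = ⌊y r / ε⌋ + N := Int.toNat_of_nonneg (hfl r).1
    have h2 : (((⌊y r / ε⌋ + N).toNat : ℕ) : ℝ) = ⌊y r / ε⌋ + N := by exact_mod_cast this
    simp only [hk]
    rw [h2]; ring
  have hround : ∀ r, |ε * (((k r : ℕ) : ℝ) - N) - y r| ≤ ε := by
    intro r
    rw [hkv]
    have h1 := Int.floor_le (y r / ε)
    have h2 := (Int.lt_floor_add_one (y r / ε)).le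
    rw [le_div_iff₀ hε] at h1
    rw [div_le_iff₀ hε] at h2
    rw [abs_le]; constructor <;> linarith
  have hsol : ∀ r, ∑ j, rowv W (B r) j * netp N ε B k W j = ε * (((k r : ℕ) : ℝ) - N) := by
    intro r
    set M := Matrix.of (fun r => rowv W (B r)) with hM
    have h1 : M.mulVec (netp N ε B k W) = fun r => ε * (((k r : ℕ) : ℝ) - N) := by
      unfold netp
      rw [← hM, Matrix.mulVec_smul, Matrix.mulVec_mulVec, Matrix.mul_adjugate,
        Matrix.smul_mulVec, Matrix.one_mulVec, smul_smul, inv_mul_cancel₀ hdet, one_smul]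
    exact congrFun h1 r
  obtain ⟨a, ha, hv⟩ := hspan i hi
  have hexp : ∀ z : Fin d → ℝ, ∑ j, rowv W i j * z j = ∑ r, a r * ∑ j, rowv W (B r) j * z j := by
    intro z
    simp only [hv, Finset.sum_apply, Pi.smul_apply, smul_eq_mul, Finset.sum_mul, Finset.mul_sum]
    rw [Finset.sum_comm]
    refine Finset.sum_congr rfl fun r _ => Finset.sum_congr rfl fun j _ => by ring
  rw [hexp, hexp, ← Finset.sum_sub_distrib]
  refine (Finset.abs_sum_le_sum_abs _ _).trans ?_
  have : ∀ r ∈ Finset.univ, |a r * ∑ j, rowv W (B r) j * netp N ε B k W j -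
      a r * ∑ j, rowv W (B r) j * θ j| ≤ ε := by
    intro r _
    rw [hsol, ← mul_sub, abs_mul]
    calc |a r| * _ ≤ 1 * ε := mul_le_mul (ha r) (hround r) (abs_nonneg _) zero_le_one
      _ = ε := one_mul _
  refine (Finset.sum_le_sum this).trans ?_
  simp

lemma count_le {n : ℕ} (X : Set (Fin n → ℝ)) (h01 : ∀ x ∈ X, ∀ i, x i = 0 ∨ x i = 1)
    (w : Fin n → ℝ) (G t : ℝ) (ht : 0 ≤ t) (hw : ∀ x ∈ X, ∑ i, x i * w i ≤ G) :
    (X.ncard : ℝ) ≤ Real.exp (t * G) * ∏ i, (1 + Real.exp (-t * w i)) := by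
  classical
  set f : (Fin n → ℝ) → Finset (Fin n) := fun x => Finset.univ.filter (fun i => x i = 1) with hf
  have hinj : Set.InjOn f X := by
    intro x hx y hy hxy
    funext i
    have h : (x i = 1 ↔ y i = 1) := by
      have := congrArg (fun s => i ∈ s) hxy
      simpa [hf] using this
    rcases h01 x hx i with h1 | h1 <;> rcases h01 y hy i with h2 | h2 <;> simp_all
  have hfin : (f '' X).Finite := Set.toFinite _
  have hc : X.ncard = hfin.toFinset.card := by
    rw [← hinj.ncard_image, Set.ncard_eq_toFinset_card _ hfin]
  rw [hc, Finset.prod_one_add, Finset.mul_sum]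
  calc ((hfin.toFinset.card : ℕ) : ℝ) = ∑ s ∈ hfin.toFinset, (1 : ℝ) := by simp
    _ ≤ ∑ s ∈ hfin.toFinset, Real.exp (t * G) * ∏ i ∈ s, Real.exp (-t * w i) := by
        refine Finset.sum_le_sum fun s hs => ?_
        obtain ⟨x, hx, rfl⟩ := by simpa using hs
        rw [← Real.exp_sum, ← Real.exp_add]
        apply Real.one_le_exp
        have h1 : ∑ i ∈ f x, -t * w i = -t * ∑ i, x i * w i := by
          rw [Finset.mul_sum, Finset.sum_filter]
          refine Finset.sum_congr rfl fun i _ => ?_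
          rcases h01 x hx i with h | h <;> simp [h]
        rw [h1]
        have := mul_le_mul_of_nonneg_left (hw x hx) ht
        linarith
    _ ≤ _ := by
        refine Finset.sum_le_sum_of_subset_of_nonneg (fun s _ => by simp) fun s _ _ => ?_
        positivity

lemma net_count (m n : ℕ) (hn : 100 * (m + 1) ≤ n) (G t : ℝ) (ht : 0 ≤ t)
    (hGn : G ≤ n / 8) (W : Fin n → Fin (m + 1) → ℝ) (lam : Fin m → ℝ) :
    ∃ (B : Fin (m + 1) → Fin n ⊕ Fin (m + 1)) (k : Fin (m + 1) → Fin (2 * n ^ 4 + 1)),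
      (∃ j, 1 ≤ |netp (n ^ 4) (1 / (n : ℝ) ^ 3) B k W j|) ∧
      ({x : Fin n → ℝ | (∀ i, x i = 0 ∨ x i = 1) ∧
            ∑ i, x i * |W i 0 - ∑ j : Fin m, W i j.succ * lam j| ≤ G}.ncard : ℝ) ≤
      Real.exp (t * (G + 1 / n)) * ∏ i, (1 + Real.exp (-t *
        |∑ j, W i j * netp (n ^ 4) (1 / (n : ℝ) ^ 3) B k W j|)) := by
  have hnd : 100 * ((m : ℝ) + 1) ≤ n := by exact_mod_cast hn
  have hm0 : (0 : ℝ) ≤ m := Nat.cast_nonneg m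
  have hn100 : (100 : ℝ) ≤ n := by linarith
  have hn0 : (0 : ℝ) < n := by linarith
  set ε : ℝ := 1 / (n : ℝ) ^ 3 with hε
  have hε0 : 0 < ε := by positivity
  set D : ℝ := ((m + 1 : ℕ) : ℝ) * ε with hD
  have hD0 : 0 ≤ D := by positivity
  have hDn : D * n ^ 2 ≤ 1 / 100 := by
    have : D * n ^ 2 = (m + 1) / n := by
      rw [hD, hε]; push_cast; field_simp
    rw [this, div_le_iff₀ hn0]; linarith
  have hD1 : D ≤ 1 := by nlinarith
  have hDn1 : D * n ≤ 1 / (100 * n) := by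
    rw [le_div_iff₀ (by positivity)]; nlinarith
  set R : ℝ := 1 + D with hR
  set p : Fin (m + 1) → ℝ := Fin.cons 1 (fun j => - lam j) with hp
  have hp1 : 1 ≤ ‖p‖ := by
    have := norm_le_pi_norm p 0
    simpa [hp] using this
  obtain ⟨j0, hj0⟩ : ∃ j, ‖p j‖ = ‖p‖ := by
    obtain ⟨j, -, hj⟩ := Finset.exists_max_image Finset.univ (fun j => ‖p j‖) ⟨0, by simp⟩
    refine ⟨j, le_antisymm (norm_le_pi_norm p j) ?_⟩
    rw [pi_norm_le_iff_of_nonneg (norm_nonneg _)]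
    exact fun i => hj i (by simp)
  set s : ℝ := R / ‖p‖ with hs
  have hp0 : 0 < ‖p‖ := by linarith
  have hR0 : 0 < R := by linarith
  have hs0 : 0 < s := by positivity
  have hsR : s ≤ R := by rw [hs]; exact div_le_self hR0.le hp1
  have hθ : ∀ j, |(s • p) j| ≤ R := by
    intro j
    rw [Pi.smul_apply, smul_eq_mul, abs_mul, abs_of_pos hs0]
    calc s * |p j| ≤ s * ‖p‖ := by
          apply mul_le_mul_of_nonneg_left _ hs0.le
          exact norm_le_pi_norm p j
      _ = R := by rw [hs]; field_simp
  have hθ0 : |(s • p) j0| = R := by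
    rw [Pi.smul_apply, smul_eq_mul, abs_mul, abs_of_pos hs0, ← Real.norm_eq_abs, hj0, hs]
    field_simp
  obtain ⟨B, k, hBk⟩ := net_exists W (s • p) ε n (n ^ 4) hε0
    (by rw [hε]; push_cast; apply le_of_eq; field_simp) (fun j => (hθ j).trans (by linarith))
  refine ⟨B, k, ⟨j0, ?_⟩, ?_⟩
  · have h := hBk (Sum.inr j0)
    simp only [rowv, Sum.elim_inr, Pi.single_apply, ite_mul, one_mul, zero_mul,
      Finset.sum_ite_eq', Finset.mem_univ, if_true] at h
    have h2 := h (by rw [hθ0]; linarith)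
    have h3 := abs_sub_abs_le_abs_sub ((s • p) j0) (netp (n ^ 4) ε B k W j0)
    rw [abs_sub_comm] at h3
    rw [hθ0] at h3
    linarith
  · refine count_le _ (fun x hx => hx.1) _ _ t ht ?_
    rintro x ⟨h01, hx⟩
    have hx0 : ∀ i, 0 ≤ x i := fun i => by rcases h01 i with h | h <;> simp [h]
    have hx1 : ∀ i, x i ≤ 1 := fun i => by rcases h01 i with h | h <;> simp [h]
    have hdot : ∀ i, ∑ j, W i j * (s • p) j = s * (W i 0 - ∑ j : Fin m, W i j.succ * lam j) := by
      intro i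
      rw [Fin.sum_univ_succ]
      simp only [hp, Pi.smul_apply, smul_eq_mul, Fin.cons_zero, Fin.cons_succ]
      rw [mul_sub, Finset.mul_sum, sub_eq_add_neg, ← Finset.sum_neg_distrib]
      congr 1
      · ring
      · refine Finset.sum_congr rfl fun j _ => by ring
    set q : Fin n → ℝ := fun i => |W i 0 - ∑ j : Fin m, W i j.succ * lam j| with hq
    have hq0 : ∀ i, 0 ≤ q i := fun i => abs_nonneg _
    have hG0 : 0 ≤ G := (Finset.sum_nonneg fun i _ => mul_nonneg (hx0 i) (hq0 i)).trans hx
    have hle : ∀ i, x i * |∑ j, W i j * netp (n ^ 4) ε B k W j| ≤ R * (x i * q i) + D := by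
      intro i
      rcases h01 i with h | h
      · rw [h]; simp [hD0]
      · rw [h, one_mul, one_mul]
        have hqi : q i ≤ G := by
          have := Finset.single_le_sum (f := fun i => x i * q i)
            (fun i _ => mul_nonneg (hx0 i) (hq0 i)) (Finset.mem_univ i)
          simp only [h, one_mul] at this
          exact this.trans hx
        have habs : |∑ j, W i j * (s • p) j| = s * q i := by
          rw [hdot, abs_mul, abs_of_pos hs0]
        have hsq : s * q i ≤ R * q i := mul_le_mul_of_nonneg_right hsR (hq0 i)
        have h2 := hBk (Sum.inl i)
        simp only [rowv, Sum.elim_inl] at h2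
        have h3 := h2 (by rw [habs]; nlinarith [hq0 i])
        have h4 := abs_sub_abs_le_abs_sub (∑ j, W i j * netp (n ^ 4) ε B k W j)
          (∑ j, W i j * (s • p) j)
        rw [habs] at h4
        linarith
    refine (Finset.sum_le_sum fun i _ => hle i).trans ?_
    rw [Finset.sum_add_distrib, ← Finset.mul_sum]
    simp only [Finset.sum_const, Finset.card_univ, Fintype.card_fin, nsmul_eq_mul]
    have h5 : R * ∑ i, x i * q i ≤ R * G := mul_le_mul_of_nonneg_left hx hR0.le
    have h6 : D * G ≤ D * n := mul_le_mul_of_nonneg_left (by linarith) hD0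
    have h7 : 1 / (100 * (n : ℝ)) = (1 / n) / 100 := by field_simp
    have h8 : 0 < 1 / (n : ℝ) := by positivity
    rw [h7] at hDn1
    have h9 : R * G = G + D * G := by rw [hR]; ring
    linarith

/-- truncated integrand -/
noncomputable def Hf (d : ℕ) (t : ℝ) (z w : Fin d → ℝ) : ℝ≥0∞ :=
  open Classical in
  if ∃ j, 1 ≤ |z j| then 1 + ENNReal.ofReal (Real.exp (-t * |∑ i, w i * z i|)) else 0

lemma Hf_measurable (d : ℕ) (t : ℝ) :
    Measurable (fun p : (Fin d → ℝ) × (Fin d → ℝ) => Hf d t p.1 p.2) := by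
  classical
  unfold Hf
  refine Measurable.ite ?_ ?_ measurable_const
  · have : {a : (Fin d → ℝ) × (Fin d → ℝ) | ∃ j, 1 ≤ |a.1 j|} = ⋃ j, {a | 1 ≤ |a.1 j|} := by
      ext a; simp
    rw [this]
    refine MeasurableSet.iUnion fun j => measurableSet_le measurable_const ?_
    fun_prop
  · fun_prop

lemma Hf_int {k : ℕ} (μ : Measure (Fin (k + 1) → ℝ)) [IsProbabilityMeasure μ]
    (hlc : IsLogConcave μ) (hμ : HasIdCovariance μ) (t : ℝ) (ht : 0 < t)
    (z : Fin (k + 1) → ℝ) : ∫⁻ w, Hf (k + 1) t z w ∂μ ≤ 1 + ENNReal.ofReal (2 / t) := by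
  unfold Hf
  by_cases h : ∃ j, 1 ≤ |z j|
  · simp only [h, if_true]
    rw [lintegral_add_left measurable_const]
    obtain ⟨j, hj⟩ := h
    have := exp_moment μ hlc hμ z j hj t ht
    simp only [lintegral_const, measure_univ, mul_one]
    gcongr
  · simp [h]

/-- rows used by a basis -/
noncomputable def usedRows {n d : ℕ} (B : Fin d → Fin n ⊕ Fin d) : Finset (Fin n) :=
  open Classical in Finset.univ.filter (fun i => ∃ r, B r = Sum.inl i)

lemma usedRows_card {n d : ℕ} (B : Fin d → Fin n ⊕ Fin d) : (usedRows B).card ≤ d := by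
  classical
  have h1 : (usedRows B).image (Sum.inl : Fin n → Fin n ⊕ Fin d) ⊆ Finset.univ.image B := by
    intro a ha
    simp only [usedRows, Finset.mem_image, Finset.mem_filter, Finset.mem_univ, true_and] at ha ⊢
    obtain ⟨i, ⟨r, hr⟩, rfl⟩ := ha
    exact ⟨r, hr⟩
  have h2 := Finset.card_le_card h1
  rw [Finset.card_image_of_injective _ Sum.inl_injective] at h2
  refine h2.trans (Finset.card_image_le.trans ?_)
  simp

lemma numerics (m n : ℕ) (hn : 100 * (m + 1) ≤ n) (G : ℝ) (hG : 0 ≤ G) :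
    (((n : ℝ) + (m + 1)) ^ (m + 1) * (2 * (n : ℝ) ^ 4 + 1) ^ (m + 1)) *
      (Real.exp (Real.sqrt (2 * n / (G + 1 / n)) * (G + 1 / n)) * 2 ^ (m + 1) *
        (1 + 2 / Real.sqrt (2 * n / (G + 1 / n))) ^ n) ≤
      60 * (357 * (n : ℝ) ^ 6) ^ (m + 2) * Real.exp (2 * Real.sqrt (2 * n * G)) := by
  have hnd : 100 * ((m : ℝ) + 1) ≤ n := by exact_mod_cast hn
  have hm0 : (0 : ℝ) ≤ m := Nat.cast_nonneg m
  have hn100 : (100 : ℝ) ≤ n := by linarith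
  have hn0 : (0 : ℝ) < n := by linarith
  set G' := G + 1 / (n : ℝ) with hG'
  have hG'0 : 0 < G' := by positivity
  set t := Real.sqrt (2 * n / G') with ht
  have ht0 : 0 < t := Real.sqrt_pos.mpr (by positivity)
  have htsq : t ^ 2 = 2 * n / G' := Real.sq_sqrt (by positivity)
  have e1 : t * G' = Real.sqrt (2 * n * G') := by
    rw [eq_comm, Real.sqrt_eq_iff_mul_self_eq (by positivity) (by positivity)]
    have : t * G' * (t * G') = t ^ 2 * G' ^ 2 := by ring
    rw [this, htsq]; field_simp
  have e2 : n * (2 / t) = Real.sqrt (2 * n * G') := by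
    rw [← e1]
    have : t ^ 2 * G' = 2 * n := by rw [htsq]; field_simp
    field_simp
    linarith
  have e3 : Real.sqrt (2 * n * G') ≤ Real.sqrt (2 * n * G) + 3 / 2 := by
    apply Real.sqrt_le_iff.mpr
    refine ⟨by positivity, ?_⟩
    have h1 : 2 * n * G' = 2 * n * G + 2 := by rw [hG']; field_simp
    have h2 := Real.sq_sqrt (show 0 ≤ 2 * n * G by positivity)
    have h3 := Real.sqrt_nonneg (2 * n * G)
    nlinarith
  have e4 : (1 + 2 / t) ^ n ≤ Real.exp (Real.sqrt (2 * n * G')) := by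
    rw [← e2, Real.exp_nat_mul]
    refine pow_le_pow_left₀ (by positivity) ?_ n
    linarith [Real.add_one_le_exp (2 / t)]
  have e5 : Real.exp (t * G') * (1 + 2 / t) ^ n ≤ 27 * Real.exp (2 * Real.sqrt (2 * n * G)) := by
    calc Real.exp (t * G') * (1 + 2 / t) ^ n
        ≤ Real.exp (Real.sqrt (2 * n * G')) * Real.exp (Real.sqrt (2 * n * G')) := by
          rw [e1]; gcongr
      _ = Real.exp (2 * Real.sqrt (2 * n * G')) := by rw [← Real.exp_add]; ring_nf
      _ ≤ Real.exp (3 + 2 * Real.sqrt (2 * n * G)) := by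
          apply Real.exp_le_exp.mpr; linarith
      _ = Real.exp 1 ^ 3 * Real.exp (2 * Real.sqrt (2 * n * G)) := by
          rw [Real.exp_add, ← Real.exp_nat_mul]; norm_num
      _ ≤ 3 ^ 3 * Real.exp (2 * Real.sqrt (2 * n * G)) := by
          gcongr
          linarith [Real.exp_one_lt_d9]
      _ = _ := by norm_num
  have e6 : ((n : ℝ) + (m + 1)) * (2 * (n : ℝ) ^ 4 + 1) * 2 ≤ 357 * (n : ℝ) ^ 6 := by
    have h4 : (1 : ℝ) ≤ (n : ℝ) ^ 4 := one_le_pow₀ (by linarith)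
    calc ((n : ℝ) + (m + 1)) * (2 * (n : ℝ) ^ 4 + 1) * 2
        ≤ (2 * n) * (3 * (n : ℝ) ^ 4) * 2 := by gcongr <;> linarith
      _ = 12 * (n : ℝ) ^ 5 := by ring
      _ ≤ 357 * (n : ℝ) ^ 6 := by
          have : (n : ℝ) ^ 6 = n ^ 5 * n := by ring
          rw [this]
          have h5 : (0 : ℝ) < (n : ℝ) ^ 5 := by positivity
          nlinarith
  have e7 : (27 : ℝ) ≤ 60 * (357 * (n : ℝ) ^ 6) := by
    have : (1 : ℝ) ≤ (n : ℝ) ^ 6 := one_le_pow₀ (by linarith)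
    linarith
  calc _ = (((n : ℝ) + (m + 1)) * (2 * (n : ℝ) ^ 4 + 1) * 2) ^ (m + 1) *
        (Real.exp (t * G') * (1 + 2 / t) ^ n) := by rw [mul_pow, mul_pow]; ring
    _ ≤ (357 * (n : ℝ) ^ 6) ^ (m + 1) * (27 * Real.exp (2 * Real.sqrt (2 * n * G))) := by
        gcongr
    _ ≤ (357 * (n : ℝ) ^ 6) ^ (m + 1) *
        (60 * (357 * (n : ℝ) ^ 6) * Real.exp (2 * Real.sqrt (2 * n * G))) := by gcongr
    _ = _ := by ring

lemma trivial_count (n : ℕ) (hn : 1 ≤ n) (G : ℝ) (hGn : (n : ℝ) / 8 ≤ G) (q : Fin n → ℝ) :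
    ({x : Fin n → ℝ | (∀ i, x i = 0 ∨ x i = 1) ∧ ∑ i, x i * q i ≤ G}.ncard : ℝ) ≤
      Real.exp (2 * Real.sqrt (2 * n * G)) := by
  have h := count_le {x : Fin n → ℝ | (∀ i, x i = 0 ∨ x i = 1) ∧ ∑ i, x i * q i ≤ G}
    (fun x hx => hx.1) q G 0 le_rfl (fun x hx => hx.2)
  refine h.trans ?_
  have hn0 : (0 : ℝ) ≤ n := Nat.cast_nonneg n
  have h1 : (n : ℝ) / 2 ≤ Real.sqrt (2 * n * G) := by
    apply Real.le_sqrt_of_sq_le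
    nlinarith
  have h2 : (2 : ℝ) ^ n ≤ Real.exp n := by
    have : Real.exp (n : ℝ) = Real.exp 1 ^ n := by rw [← Real.exp_nat_mul]; simp
    rw [this]
    refine pow_le_pow_left₀ (by norm_num) ?_ n
    linarith [Real.add_one_le_exp (1 : ℝ)]
  have h3 : Real.exp (n : ℝ) ≤ Real.exp (2 * Real.sqrt (2 * n * G)) := by
    apply Real.exp_le_exp.mpr; linarith
  have h4 : Real.exp (0 * G) * ∏ i, (1 + Real.exp (-0 * q i)) = 2 ^ n := by
    simp; norm_num
  rw [h4]
  linarith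

lemma prod_le_H {n d : ℕ} (t : ℝ) (ht : 0 ≤ t) (B : Fin d → Fin n ⊕ Fin d) (z : Fin d → ℝ)
    (hz : ∃ j, 1 ≤ |z j|) (W : Fin n → Fin d → ℝ) :
    ENNReal.ofReal (∏ i, (1 + Real.exp (-t * |∑ j, W i j * z j|))) ≤
      2 ^ d * ∏ i ∈ (usedRows B)ᶜ, Hf d t z (W i) := by
  rw [ENNReal.ofReal_prod_of_nonneg (fun i _ => by positivity),
    ← Finset.prod_mul_prod_compl (usedRows B)]
  refine mul_le_mul' ?_ ?_
  · refine (Finset.prod_le_prod' (g := fun _ => (2 : ℝ≥0∞)) fun i _ => ?_).trans ?_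
    · have : Real.exp (-t * |∑ j, W i j * z j|) ≤ 1 := by
        apply Real.exp_le_one_iff.mpr
        have := mul_nonneg ht (abs_nonneg (∑ j, W i j * z j))
        linarith
      refine (ENNReal.ofReal_le_ofReal (show _ ≤ (2 : ℝ) by linarith)).trans ?_
      simp
    · rw [Finset.prod_const]
      exact pow_le_pow_right₀ (by norm_num) (usedRows_card B)
  · refine Finset.prod_le_prod' fun i _ => ?_
    unfold Hf
    rw [if_pos hz, ENNReal.ofReal_add zero_le_one (by positivity), ENNReal.ofReal_one]

/-- for `n ≥ 100(m+1)`, `b ∈ ℝ^m`, and a random matrix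
`W = [cᵀ; A] ∈ ℝ^{(m+1)×n}` (column `i` being `(cᵢ, A_{·,i})`) with independent logconcave
identity-covariance columns, for `G ≥ 0` and `δ ∈ (0,1)`, with probability at least
`1 − δ − e^{−n/5}` every `λ ∈ ℝ^m` satisfies
`|{x ∈ {0,1}ⁿ : Σᵢ xᵢ·|(c − Aᵀλ)ᵢ| ≤ G}| ≤ 60·(357n⁶)^{m+2}·e^{2√(2nG)}/δ`. -/
theorem stmt_19 (m n : ℕ) (hn : 100 * (m + 1) ≤ n) (b : Fin m → ℝ) (G : ℝ) (hG : 0 ≤ G)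
    (μ : Fin n → Measure (Fin (m + 1) → ℝ))
    [∀ i, IsProbabilityMeasure (μ i)]
    (hlc : ∀ i, IsLogConcave (μ i)) (hcov : ∀ i, HasIdCovariance (μ i))
    (δ : ℝ) (hδ : δ ∈ Set.Ioo (0 : ℝ) 1) :
    (Measure.pi μ)
      {W : Fin n → Fin (m + 1) → ℝ | ∀ lam : Fin m → ℝ,
        ({x : Fin n → ℝ | (∀ i, x i = 0 ∨ x i = 1) ∧
            ∑ i, x i * |W i 0 - ∑ j : Fin m, W i j.succ * lam j| ≤ G}.ncard : ℝ)
          ≤ 60 * (357 * (n : ℝ) ^ 6) ^ (m + 2) * Real.exp (2 * Real.sqrt (2 * n * G)) / δ}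
      ≥ ENNReal.ofReal (1 - δ - Real.exp (-(n : ℝ) / 5)) := by
  obtain ⟨hδ0, hδ1⟩ := hδ
  have hnd : 100 * ((m : ℝ) + 1) ≤ n := by exact_mod_cast hn
  have hm0 : (0 : ℝ) ≤ m := Nat.cast_nonneg m
  have hn100 : (100 : ℝ) ≤ n := by linarith
  have hn0 : (0 : ℝ) < n := by linarith
  have hexp0 := Real.exp_pos (-(n : ℝ) / 5)
  rcases le_or_gt ((n : ℝ) / 8) G with hbig | hsmall
  · have huniv : {W : Fin n → Fin (m + 1) → ℝ | ∀ lam : Fin m → ℝ,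
        ({x : Fin n → ℝ | (∀ i, x i = 0 ∨ x i = 1) ∧
            ∑ i, x i * |W i 0 - ∑ j : Fin m, W i j.succ * lam j| ≤ G}.ncard : ℝ)
          ≤ 60 * (357 * (n : ℝ) ^ 6) ^ (m + 2) * Real.exp (2 * Real.sqrt (2 * n * G)) / δ}
        = Set.univ := by
      refine Set.eq_univ_of_forall fun W lam => ?_
      refine (trivial_count n (by omega) G hbig _).trans ?_
      rw [le_div_iff₀ hδ0]
      have h1 : (1 : ℝ) ≤ (357 * (n : ℝ) ^ 6) ^ (m + 2) := by
        apply one_le_pow₀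
        have : (1 : ℝ) ≤ (n : ℝ) ^ 6 := one_le_pow₀ (by linarith)
        linarith
      have h2 := Real.exp_pos (2 * Real.sqrt (2 * n * G))
      nlinarith
    rw [huniv, measure_univ]
    refine (ENNReal.ofReal_le_ofReal (show _ ≤ (1 : ℝ) by linarith)).trans ?_
    simp
  · set t := Real.sqrt (2 * n / (G + 1 / n)) with ht
    have ht0 : 0 < t := Real.sqrt_pos.mpr (by positivity)
    set K : ℝ≥0∞ := ENNReal.ofReal (Real.exp (t * (G + 1 / n))) * 2 ^ (m + 1) with hK
    set P : (Fin (m + 1) → Fin n ⊕ Fin (m + 1)) × (Fin (m + 1) → Fin (2 * n ^ 4 + 1)) →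
      (Fin n → Fin (m + 1) → ℝ) → ℝ≥0∞ := fun Bk W =>
        ∏ i ∈ (usedRows Bk.1)ᶜ, Hf (m + 1) t (netp (n ^ 4) (1 / (n : ℝ) ^ 3) Bk.1 Bk.2 W) (W i)
      with hP
    have hPm : ∀ Bk, Measurable (P Bk) := by
      intro Bk
      refine Finset.measurable_prod _ fun i _ => ?_
      exact (Hf_measurable (m + 1) t).comp
        ((netp_measurable _ _ _ _).prodMk (measurable_pi_apply i))
    set Z : (Fin n → Fin (m + 1) → ℝ) → ℝ≥0∞ := fun W => ∑ Bk, K * P Bk W with hZ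
    have hZm : Measurable Z := Finset.measurable_sum _ fun Bk _ => (hPm Bk).const_mul K
    set C : ℝ≥0∞ := 1 + ENNReal.ofReal (2 / t) with hC
    have hPint : ∀ Bk, ∫⁻ W, P Bk W ∂(Measure.pi μ) ≤ C ^ n := by
      intro Bk
      refine (fubini_bound μ (usedRows Bk.1) (netp (n ^ 4) (1 / (n : ℝ) ^ 3) Bk.1 Bk.2)
        (netp_measurable _ _ _ _) ?_ (Hf (m + 1) t) (Hf_measurable _ _) C
        (fun z i => Hf_int (μ i) (hlc i) (hcov i) t ht0 z)).trans ?_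
      · intro W W' h
        refine netp_dep _ _ _ _ _ _ fun i hi => h i ?_
        simpa [usedRows] using hi
      · refine pow_le_pow_right₀ (by simp [hC]) ?_
        exact (Finset.card_le_univ _).trans (by simp)
    set Bd : ℝ := 60 * (357 * (n : ℝ) ^ 6) ^ (m + 2) * Real.exp (2 * Real.sqrt (2 * n * G)) / δ
      with hBd
    have hBd0 : 0 < Bd := by positivity
    have hZint : ∫⁻ W, Z W ∂(Measure.pi μ) ≤ ENNReal.ofReal (δ * Bd) := by
      rw [hZ, lintegral_finsetSum _ (fun Bk _ => (hPm Bk).const_mul K)]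
      refine (Finset.sum_le_sum (g := fun _ => K * C ^ n) fun Bk _ => ?_).trans ?_
      · rw [lintegral_const_mul _ (hPm Bk)]
        exact mul_le_mul' le_rfl (hPint Bk)
      · have hKC : K * C ^ n = ENNReal.ofReal (Real.exp (t * (G + 1 / n)) * 2 ^ (m + 1) *
            (1 + 2 / t) ^ n) := by
          rw [ENNReal.ofReal_mul (by positivity), ENNReal.ofReal_mul (by positivity),
            ENNReal.ofReal_pow (by positivity), ENNReal.ofReal_pow (by positivity),
            ENNReal.ofReal_add zero_le_one (by positivity), ENNReal.ofReal_one, hK, hC]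
          simp
        rw [Finset.sum_const, hKC, nsmul_eq_mul, ← ENNReal.ofReal_natCast,
          ← ENNReal.ofReal_mul (by positivity)]
        apply ENNReal.ofReal_le_ofReal
        have hnum := numerics m n hn G hG
        have h1 : δ * Bd = 60 * (357 * (n : ℝ) ^ 6) ^ (m + 2) *
            Real.exp (2 * Real.sqrt (2 * n * G)) := by rw [hBd]; field_simp
        rw [h1]
        refine le_trans (le_of_eq ?_) hnum
        rw [← ht]
        congr 1
        simp [Finset.card_univ, Fintype.card_prod, Fintype.card_sum]
    have hmarkov : (Measure.pi μ) {W | ENNReal.ofReal Bd ≤ Z W} ≤ ENNReal.ofReal δ := by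
      refine (meas_ge_le_lintegral_div hZm.aemeasurable (by simpa using hBd0)
        ENNReal.ofReal_ne_top).trans ?_
      refine ENNReal.div_le_of_le_mul ?_
      rw [← ENNReal.ofReal_mul hδ0.le]
      exact hZint
    have hsub : {W | ENNReal.ofReal Bd ≤ Z W}ᶜ ⊆ {W : Fin n → Fin (m + 1) → ℝ |
        ∀ lam : Fin m → ℝ,
        ({x : Fin n → ℝ | (∀ i, x i = 0 ∨ x i = 1) ∧
            ∑ i, x i * |W i 0 - ∑ j : Fin m, W i j.succ * lam j| ≤ G}.ncard : ℝ) ≤ Bd} := by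
      intro W hW lam
      have hW' : Z W < ENNReal.ofReal Bd := not_le.mp hW
      obtain ⟨B, k, hz, hcount⟩ := net_count m n hn G t ht0.le hsmall.le W lam
      have h1 := ENNReal.ofReal_le_ofReal hcount
      rw [ENNReal.ofReal_mul (by positivity)] at h1
      have h2 : ENNReal.ofReal (Real.exp (t * (G + 1 / n))) * ENNReal.ofReal (∏ i, (1 +
          Real.exp (-t * |∑ j, W i j * netp (n ^ 4) (1 / (n : ℝ) ^ 3) B k W j|)))
          ≤ K * P (B, k) W := by
        rw [hK, mul_assoc]
        exact mul_le_mul' le_rfl (prod_le_H t ht0.le B _ hz W)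
      have h3 : K * P (B, k) W ≤ Z W :=
        Finset.single_le_sum (f := fun Bk => K * P Bk W) (fun _ _ => zero_le) (Finset.mem_univ _)
      have h4 := (h1.trans (h2.trans h3)).trans hW'.le
      exact (ENNReal.ofReal_le_ofReal_iff hBd0.le).mp h4
    refine ge_iff_le.mpr (le_trans ?_ (measure_mono hsub))
    rw [prob_compl_eq_one_sub (measurableSet_le measurable_const hZm)]
    calc ENNReal.ofReal (1 - δ - Real.exp (-(n : ℝ) / 5)) ≤ ENNReal.ofReal (1 - δ) :=
          ENNReal.ofReal_le_ofReal (by linarith)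
      _ = 1 - ENNReal.ofReal δ := by rw [ENNReal.ofReal_sub _ hδ0.le, ENNReal.ofReal_one]
      _ ≤ _ := tsub_le_tsub_left hmarkov 1
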